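/- arXiv:1210.0117 — 13 statements merged into one kernel-verified Lean document; each statement's English description precedes it below -/
import Mathlib

section
/- Let V ⊆ ℝ≥0^n be a tropical cone and let y ∈ ℝ≥0^n with y ≠ 0. Then y ∈ V if and only if for every i ∈ supp(y) there exists x ∈ V with x ≠ 0 and x ∈ W_i(y). -/
open scoped NNReal

/-- A set in `ℝ≥0^n` is tropically convex (max-times model). -/
def TropConvex {n : ℕ} (C : Set (Fin n → ℝ≥0)) : Prop :=
  ∀ x ∈ C, ∀ y ∈ C, ∀ α β : ℝ≥0, max α β = 1 →
    (fun i => max (α * x i) (β * y i)) ∈ C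

/-- A tropical cone: a nonempty set closed under coordinatewise max and scalar multiplication. -/
def TropCone {n : ℕ} (V : Set (Fin n → ℝ≥0)) : Prop :=
  V.Nonempty ∧ (∀ x ∈ V, ∀ y ∈ V, (fun i => max (x i) (y i)) ∈ V) ∧
    ∀ x ∈ V, ∀ lam : ℝ≥0, (fun i => lam * x i) ∈ V

/-- Support of a vector. -/
def supp {n : ℕ} (x : Fin n → ℝ≥0) : Set (Fin n) := {i | x i ≠ 0}

/-- Quasisector of type `i` at `y`. -/
def quasiSector {n : ℕ} (y : Fin n → ℝ≥0) (i : Fin n) : Set (Fin n → ℝ≥0) :=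
  {x | (∀ j ∈ supp y, x j * y i ≤ x i * y j) ∧ ∀ j ∉ supp y, x j = 0}

theorem TropCone.sup_mem {n : ℕ} {V : Set (Fin n → ℝ≥0)} (hV : TropCone V) {ι : Type*}
    (s : Finset ι) (z : ι → Fin n → ℝ≥0) (hz : ∀ i ∈ s, z i ∈ V) : s.sup z ∈ V := by
  obtain ⟨⟨v, hv⟩, hmax, hsmul⟩ := hV
  refine Finset.sup_induction (p := (· ∈ V)) ?_ (fun a ha b hb => hmax a ha b hb) hz
  have h := hsmul v hv 0
  simp only [zero_mul] at h
  exact h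

/-- A nonzero vector of the quasisector of type `i` at `y` has nonzero `i`-th coordinate. -/
theorem apply_ne_zero_of_mem_quasiSector {n : ℕ} {x y : Fin n → ℝ≥0} {i : Fin n}
    (hi : i ∈ supp y) (hx : x ≠ 0) (h : x ∈ quasiSector y i) : x i ≠ 0 := by
  intro h0
  refine hx (funext fun j => ?_)
  by_cases hj : j ∈ supp y
  · have hle := h.1 j hj
    rw [h0, zero_mul, nonpos_iff_eq_zero, mul_eq_zero] at hle
    exact hle.resolve_right hi
  · exact h.2 j hj

/-- A nonzero vector of the quasisector of type `i` at `y` can be scaled to lie below `y` and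
agree with `y` at `i`. -/
theorem TropCone.exists_le_of_mem_quasiSector {n : ℕ} {V : Set (Fin n → ℝ≥0)} (hV : TropCone V)
    {x y : Fin n → ℝ≥0} {i : Fin n} (hi : i ∈ supp y) (hxV : x ∈ V) (hx : x ≠ 0)
    (h : x ∈ quasiSector y i) : ∃ z ∈ V, z ≤ y ∧ z i = y i := by
  have hxi := apply_ne_zero_of_mem_quasiSector hi hx h
  refine ⟨_, hV.2.2 x hxV (y i / x i), fun j => ?_, div_mul_cancel₀ _ hxi⟩
  by_cases hj : j ∈ supp y
  · have hle := h.1 j hj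
    change y i / x i * x j ≤ y j
    rw [div_mul_eq_mul_div, div_le_iff₀ (pos_iff_ne_zero.mpr hxi)]
    linarith [mul_comm (y i) (x j), mul_comm (x i) (y j)]
  · simp [h.2 j hj]

theorem stmt0 {n : ℕ} (V : Set (Fin n → ℝ≥0)) (hV : TropCone V)
    (y : Fin n → ℝ≥0) (hy : y ≠ 0) :
    y ∈ V ↔ ∀ i ∈ supp y, ∃ x ∈ V, x ≠ 0 ∧ x ∈ quasiSector y i := by
  refine ⟨fun hyV i _ => ⟨y, hyV, hy, fun j _ => (mul_comm _ _).le, fun j hj => not_not.mp hj⟩,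
    fun h => ?_⟩
  have hz : ∀ i, ∃ z ∈ V, z ≤ y ∧ z i = y i := fun i => by
    by_cases hi : i ∈ supp y
    · obtain ⟨x, hxV, hx, hxi⟩ := h i hi
      exact hV.exists_le_of_mem_quasiSector hi hxV hx hxi
    · refine ⟨_, hV.sup_mem (∅ : Finset (Fin n)) (fun _ => y) (by simp), by simp, ?_⟩
      simpa using (not_not.mp hi).symm
  choose z hzV hzy hzi using hz
  have hsup : Finset.univ.sup z = y := by
    refine le_antisymm (Finset.sup_le fun i _ => hzy i) fun i => ?_
    rw [← hzi i]
    exact Finset.le_sup (f := z) (Finset.mem_univ i) i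
  exact hsup ▸ hV.sup_mem Finset.univ z fun i _ => hzV i
end

section
/- Let y ∈ ℝ≥0^n with y ≠ 0. A set V ⊆ ℝ≥0^n is a quasisemispace at y — i.e., a tropical cone not containing y that is maximal with respect to inclusion among tropical cones not containing y — if and only if V = (ℝ≥0^n \ W_i(y)) ∪ {0} for some i ∈ supp(y). Moreover, the sets (ℝ≥0^n \ W_i(y)) ∪ {0} for i ∈ supp(y) are pairwise distinct, so there are exactly as many quasisemispaces at y as elements of supp(y). -/
open scoped NNReal

/-- A quasisemispace at `y`: a maximal tropical cone not containing `y`. -/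
def IsQuasiSemispace {n : ℕ} (V : Set (Fin n → ℝ≥0)) (y : Fin n → ℝ≥0) : Prop :=
  TropCone V ∧ y ∉ V ∧
    ∀ W : Set (Fin n → ℝ≥0), TropCone W → y ∉ W → V ⊆ W → W = V

/-- A vector of a quasisector of type `i` whose `i`-th coordinate vanishes is zero. -/
lemma quasiSector_eq_zero {n : ℕ} {y x : Fin n → ℝ≥0} {i : Fin n} (hi : i ∈ supp y)
    (hx : x ∈ quasiSector y i) (h : x i = 0) : x = 0 := by
  funext j
  by_cases hj : j ∈ supp y
  · have h1 := hx.1 j hj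
    rw [h, zero_mul] at h1
    exact (mul_eq_zero.1 (le_antisymm h1 zero_le)).resolve_right hi
  · exact hx.2 j hj

lemma quasiSector_of_le {n : ℕ} {y x z : Fin n → ℝ≥0} {i : Fin n}
    (hz : z ∈ quasiSector y i) (hle : x ≤ z) (h : z i = x i) : x ∈ quasiSector y i :=
  ⟨fun j hj => (mul_le_mul_left (hle j) _).trans (h ▸ hz.1 j hj),
    fun j hj => le_antisymm ((hle j).trans (hz.2 j hj).le) zero_le⟩

lemma tropCone_compl_quasiSector {n : ℕ} {y : Fin n → ℝ≥0} {i : Fin n} (hi : i ∈ supp y) :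
    TropCone ((quasiSector y i)ᶜ ∪ {0}) := by
  refine ⟨⟨0, Or.inr rfl⟩, fun x hx z hz => ?_, fun x hx c => ?_⟩
  · by_contra hcon
    obtain ⟨hm, hne⟩ : x ⊔ z ∈ quasiSector y i ∧ x ⊔ z ≠ 0 :=
      ⟨not_not.1 fun h => hcon (Or.inl h), fun h => hcon (Or.inr h)⟩
    rcases le_total (x i) (z i) with h | h
    · have hmi : (x ⊔ z) i = z i := sup_eq_right.2 h
      have hz0 : z = 0 := hz.resolve_left (not_not.2 (quasiSector_of_le hm le_sup_right hmi))
      exact hne (quasiSector_eq_zero hi hm (by rw [hmi, hz0]; rfl))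
    · have hmi : (x ⊔ z) i = x i := sup_eq_left.2 h
      have hx0 : x = 0 := hx.resolve_left (not_not.2 (quasiSector_of_le hm le_sup_left hmi))
      exact hne (quasiSector_eq_zero hi hm (by rw [hmi, hx0]; rfl))
  · rcases eq_or_ne c 0 with rfl | hc
    · exact Or.inr (by ext; simp)
    rcases hx with hx | rfl
    · refine Or.inl fun hcx => hx ⟨fun j hj => ?_, fun j hj => ?_⟩
      · have h := hcx.1 j hj
        simp only [mul_assoc] at h
        exact le_of_mul_le_mul_left h (pos_iff_ne_zero.2 hc)
      · exact (mul_eq_zero.1 (hcx.2 j hj)).resolve_left hc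
    · exact Or.inr (by ext; simp)

lemma notMem_compl_quasiSector {n : ℕ} {y : Fin n → ℝ≥0} (hy : y ≠ 0) (i : Fin n) :
    y ∉ (quasiSector y i)ᶜ ∪ {0} := by
  rintro (h | h)
  · exact h ⟨fun j _ => (mul_comm _ _).le, fun j hj => not_not.1 hj⟩
  · exact hy h

/-- A tropical cone avoiding `y` meets some quasisector at `y` only in zero. -/
lemma TropCone.exists_subset_compl_quasiSector {n : ℕ} {V : Set (Fin n → ℝ≥0)}
    {y : Fin n → ℝ≥0} (hV : TropCone V) (hyV : y ∉ V) :
    ∃ i ∈ supp y, V ⊆ (quasiSector y i)ᶜ ∪ {0} := by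
  by_contra! hcon
  obtain ⟨⟨v, hv⟩, hmax, hsmul⟩ := hV
  have h0 : (⊥ : Fin n → ℝ≥0) ∈ V := by
    convert hsmul v hv 0 using 1
    ext j
    simp
  have key : ∀ i, ∃ u ∈ V, u ≤ y ∧ u i = y i := by
    intro i
    by_cases hi : i ∈ supp y
    · obtain ⟨x, hxV, hx⟩ := Set.not_subset.1 (hcon i hi)
      obtain ⟨hxW, hx0⟩ : x ∈ quasiSector y i ∧ x ≠ 0 :=
        ⟨not_not.1 fun h => hx (Or.inl h), fun h => hx (Or.inr h)⟩
      have hxi : x i ≠ 0 := fun h => hx0 (quasiSector_eq_zero hi hxW h)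
      refine ⟨_, hsmul x hxV (y i / x i), fun j => ?_, div_mul_cancel₀ _ hxi⟩
      by_cases hj : j ∈ supp y
      · change y i / x i * x j ≤ y j
        rw [div_mul_eq_mul_div, div_le_iff₀ (pos_iff_ne_zero.2 hxi), mul_comm (y i),
          mul_comm (y j)]
        exact hxW.1 j hj
      · simp [hxW.2 j hj]
    · exact ⟨⊥, h0, bot_le, (not_not.1 hi).symm⟩
  choose u huV hule hui using key
  have hsup : Finset.univ.sup u ∈ V :=
    Finset.sup_mem V h0 (fun a ha b hb => hmax a ha b hb) _ _ fun i _ => huV i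
  have heq : Finset.univ.sup u = y :=
    le_antisymm (Finset.sup_le fun i _ => hule i) fun i =>
      (hui i).symm.le.trans (Finset.le_sup (f := u) (Finset.mem_univ i) i)
  exact hyV (heq ▸ hsup)

lemma eq_of_compl_quasiSector_subset {n : ℕ} {y : Fin n → ℝ≥0} {i j : Fin n}
    (hi : i ∈ supp y) (hj : j ∈ supp y)
    (h : (quasiSector y i)ᶜ ∪ {0} ⊆ (quasiSector y j)ᶜ ∪ {0}) : i = j := by
  by_contra hij
  have hne : (Pi.single j 1 : Fin n → ℝ≥0) ≠ 0 := by simp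
  have hmem : (Pi.single j 1 : Fin n → ℝ≥0) ∈ quasiSector y j := by
    refine ⟨fun k _ => ?_, fun k hk => ?_⟩
    · rcases eq_or_ne k j with rfl | hkj
      · simp
      · simp [hkj]
    · exact Pi.single_eq_of_ne (fun hkj : k = j => hk (hkj ▸ hj)) _
  have hnot : (Pi.single j 1 : Fin n → ℝ≥0) ∉ quasiSector y i := fun hW =>
    hne (quasiSector_eq_zero hi hW (Pi.single_eq_of_ne hij _))
  exact (h (Or.inl hnot)).elim (fun h' => h' hmem) hne

theorem stmt1 {n : ℕ} (y : Fin n → ℝ≥0) (hy : y ≠ 0) :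
    (∀ V : Set (Fin n → ℝ≥0),
      IsQuasiSemispace V y ↔ ∃ i ∈ supp y, V = (quasiSector y i)ᶜ ∪ {0}) ∧
    (∀ i ∈ supp y, ∀ j ∈ supp y,
      (quasiSector y i)ᶜ ∪ {0} = (quasiSector y j)ᶜ ∪ {0} → i = j) := by
  refine ⟨fun V => ⟨fun ⟨hV, hyV, hmax⟩ => ?_, ?_⟩,
    fun i hi j hj h => eq_of_compl_quasiSector_subset hi hj h.subset⟩
  · obtain ⟨i, hi, hsub⟩ := hV.exists_subset_compl_quasiSector hyV
    exact ⟨i, hi, (hmax _ (tropCone_compl_quasiSector hi)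
      (notMem_compl_quasiSector hy i) hsub).symm⟩
  · rintro ⟨i, hi, rfl⟩
    refine ⟨tropCone_compl_quasiSector hi, notMem_compl_quasiSector hy i,
      fun W hW hyW hsub => ?_⟩
    obtain ⟨j, hj, hWj⟩ := hW.exists_subset_compl_quasiSector hyW
    obtain rfl := eq_of_compl_quasiSector_subset hi hj (hsub.trans hWj)
    exact hWj.antisymm hsub
end

section
/- Let x, y ∈ ℝ≥0^n with supp(x) ∩ supp(y) ≠ ∅, and let i ∈ supp(x) ∩ supp(y). Define z ∈ ℝ≥0^n by z_j := min(x_j·x_i⁻¹, y_j·y_i⁻¹) for each j (inverses in ℝ≥0; note x_i ≠ 0 and y_i ≠ 0). Then z ≠ 0 and z ∈ W_i(x) ∩ W_i(y). -/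
open scoped NNReal

theorem mem_quasiSector_of_le_mul_inv {n : ℕ} {x z : Fin n → ℝ≥0} {i : Fin n}
    (hx : i ∈ supp x) (hzi : z i = 1) (hz : ∀ j, z j ≤ x j * (x i)⁻¹) :
    z ∈ quasiSector x i := by
  have hxi : x i ≠ 0 := hx
  refine ⟨fun j _ => ?_, fun j hj => ?_⟩
  · calc z j * x i ≤ x j * (x i)⁻¹ * x i := mul_le_mul_left (hz j) _
      _ = z i * x j := by rw [inv_mul_cancel_right₀ hxi, hzi, one_mul]
  · have hxj : x j = 0 := not_not.mp hj
    simpa [hxj] using hz j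

theorem stmt2 {n : ℕ} (x y : Fin n → ℝ≥0) (i : Fin n)
    (hx : i ∈ supp x) (hy : i ∈ supp y) :
    (fun j => min (x j * (x i)⁻¹) (y j * (y i)⁻¹)) ≠ (0 : Fin n → ℝ≥0) ∧
    (fun j => min (x j * (x i)⁻¹) (y j * (y i)⁻¹)) ∈ quasiSector x i ∩ quasiSector y i := by
  have hxi : x i ≠ 0 := hx
  have hyi : y i ≠ 0 := hy
  have hi : min (x i * (x i)⁻¹) (y i * (y i)⁻¹) = 1 := by
    rw [mul_inv_cancel₀ hxi, mul_inv_cancel₀ hyi, min_self]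
  exact ⟨fun h => one_ne_zero (hi.symm.trans (congrFun h i)),
    mem_quasiSector_of_le_mul_inv hx hi fun _ => min_le_left _ _,
    mem_quasiSector_of_le_mul_inv hy hi fun _ => min_le_right _ _⟩
end

section
/- Let (V1, V2) be a non-trivial joined pair of conical hemispaces in ℝ≥0^n. Then there exist disjoint subsets I, J of {1,…,n} such that V1 = ⋃{W_i(y) : y ∈ V1, y ≠ 0, i ∈ I ∩ supp(y), W_i(y) ⊆ V1} and V2 = ⋃{W_j(y) : y ∈ V2, y ≠ 0, j ∈ J ∩ supp(y), W_j(y) ⊆ V2}. -/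
open scoped NNReal

theorem TropCone.zero_mem {n : ℕ} {V : Set (Fin n → ℝ≥0)} (h : TropCone V) : 0 ∈ V := by
  obtain ⟨⟨x, hx⟩, -, hsmul⟩ := h
  simpa [Pi.zero_def] using hsmul x hx 0

theorem TropCone.finset_sup_mem {n : ℕ} {ι : Type*} {V : Set (Fin n → ℝ≥0)} (h : TropCone V)
    (s : Finset ι) (f : ι → Fin n → ℝ≥0) (hf : ∀ i ∈ s, f i ∈ V) : s.sup f ∈ V :=
  Finset.sup_induction (p := (· ∈ V)) h.zero_mem (fun x hx y hy => h.2.1 x hx y hy) hf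

theorem zero_mem_quasiSector {n : ℕ} (y : Fin n → ℝ≥0) (i : Fin n) : 0 ∈ quasiSector y i := by
  simp [quasiSector]

theorem self_mem_quasiSector {n : ℕ} (y : Fin n → ℝ≥0) (i : Fin n) : y ∈ quasiSector y i :=
  ⟨fun j _ => (mul_comm (y j) (y i)).le, fun j hj => by simpa [supp] using hj⟩

theorem single_mem_quasiSector {n : ℕ} {y : Fin n → ℝ≥0} {i : Fin n} (hi : i ∈ supp y) :
    Pi.single i 1 ∈ quasiSector y i := by
  refine ⟨fun j _ => ?_, fun j hj => ?_⟩
  · by_cases hji : j = i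
    · subst hji; simp
    · simp [Pi.single_eq_of_ne hji]
  · exact Pi.single_eq_of_ne (fun hji : j = i => hj (hji ▸ hi)) _

/-- A nonzero vector of a quasisector of type `i` has a nonzero `i`-th coordinate. -/
theorem ne_zero_of_mem_quasiSector {n : ℕ} {x y : Fin n → ℝ≥0} {i : Fin n}
    (hi : i ∈ supp y) (hx : x ∈ quasiSector y i) (hx0 : x ≠ 0) : x i ≠ 0 := by
  intro hxi
  refine hx0 (funext fun j => ?_)
  by_cases hj : j ∈ supp y
  · have h := hx.1 j hj
    rw [hxi, zero_mul] at h
    exact (mul_eq_zero.1 (le_antisymm h (zero_le))).resolve_right hi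
  · exact hx.2 j hj

/-- If a tropical cone meets every quasisector at `y` outside the origin, then it contains `y`. -/
theorem TropCone.mem_of_forall_quasiSector {n : ℕ} {V : Set (Fin n → ℝ≥0)} (h : TropCone V)
    (y : Fin n → ℝ≥0) (hy : ∀ i ∈ supp y, ∃ x ∈ quasiSector y i, x ∈ V ∧ x ≠ 0) : y ∈ V := by
  classical
  choose! f hfy hfV hf0 using hy
  let g : Fin n → Fin n → ℝ≥0 := fun i k => (y i / f i i) * f i k
  suffices hsup : (Finset.univ.filter (· ∈ supp y)).sup g = y by
    rw [← hsup]
    exact h.finset_sup_mem _ _ fun i hi => h.2.2 _ (hfV i (by simpa using hi)) _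
  apply le_antisymm
  · refine Finset.sup_le fun i hi k => ?_
    replace hi : i ∈ supp y := by simpa using hi
    have hne := ne_zero_of_mem_quasiSector hi (hfy i hi) (hf0 i hi)
    by_cases hk : k ∈ supp y
    · have hle := (hfy i hi).1 k hk
      change y i / f i i * f i k ≤ y k
      rw [div_mul_eq_mul_div, div_le_iff₀ (pos_iff_ne_zero.2 hne), mul_comm (y i),
        mul_comm (y k)]
      exact hle
    · change y i / f i i * f i k ≤ y k
      simp [(hfy i hi).2 k hk]
  · intro i
    by_cases hi : i ∈ supp y
    · have hne := ne_zero_of_mem_quasiSector hi (hfy i hi) (hf0 i hi)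
      calc y i = g i i := (div_mul_cancel₀ (y i) hne).symm
        _ ≤ _ := Finset.le_sup (f := g) (by simpa using hi) i
    · have hyi : y i = 0 := by simpa [supp] using hi
      rw [hyi]
      exact zero_le

theorem eq_union_quasiSector {n : ℕ} {V V' : Set (Fin n → ℝ≥0)} (h : TropCone V)
    (h' : TropCone V') (hcap : V ∩ V' = {0}) (hcup : V ∪ V' = Set.univ) (hnt : V ≠ {0}) :
    V = {x | ∃ y ∈ V, y ≠ 0 ∧ ∃ i ∈ {i | Pi.single i 1 ∈ V}, i ∈ supp y ∧
      quasiSector y i ⊆ V ∧ x ∈ quasiSector y i} := by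
  have key : ∀ y ∈ V, y ≠ 0 → ∃ i ∈ supp y, quasiSector y i ⊆ V := by
    intro y hy hy0
    by_contra! hcon
    have hyV' : y ∈ V' := by
      refine h'.mem_of_forall_quasiSector y fun i hi => ?_
      obtain ⟨x, hx, hxV⟩ := Set.not_subset.1 (hcon i hi)
      have hxcup : x ∈ V ∪ V' := hcup ▸ Set.mem_univ x
      exact ⟨x, hx, hxcup.resolve_left hxV, fun hx0 => hxV (hx0 ▸ h.zero_mem)⟩
    have hycap : y ∈ V ∩ V' := ⟨hy, hyV'⟩
    rw [hcap] at hycap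
    exact hy0 hycap
  refine Set.Subset.antisymm (fun x hx => ?_) ?_
  · by_cases hx0 : x = 0
    · obtain ⟨y, hy, hy0⟩ : ∃ y ∈ V, y ≠ 0 := by
        by_contra! hcon
        exact hnt (Set.Subset.antisymm hcon (Set.singleton_subset_iff.2 h.zero_mem))
      obtain ⟨i, hi, hsub⟩ := key y hy hy0
      exact ⟨y, hy, hy0, i, hsub (single_mem_quasiSector hi), hi, hsub,
        hx0 ▸ zero_mem_quasiSector y i⟩
    · obtain ⟨i, hi, hsub⟩ := key x hx hx0
      exact ⟨x, hx, hx0, i, hsub (single_mem_quasiSector hi), hi, hsub,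
        self_mem_quasiSector x i⟩
  · rintro x ⟨y, -, -, i, -, -, hsub, hx⟩
    exact hsub hx

theorem stmt3 {n : ℕ} (V1 V2 : Set (Fin n → ℝ≥0))
    (h1 : TropCone V1) (h2 : TropCone V2)
    (hcap : V1 ∩ V2 = {0}) (hcup : V1 ∪ V2 = Set.univ)
    (hnt1 : V1 ≠ {0}) (hnt2 : V2 ≠ {0}) :
    ∃ I J : Set (Fin n), Disjoint I J ∧
      V1 = {x | ∃ y ∈ V1, y ≠ 0 ∧ ∃ i ∈ I, i ∈ supp y ∧
              quasiSector y i ⊆ V1 ∧ x ∈ quasiSector y i} ∧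
      V2 = {x | ∃ y ∈ V2, y ≠ 0 ∧ ∃ j ∈ J, j ∈ supp y ∧
              quasiSector y j ⊆ V2 ∧ x ∈ quasiSector y j} := by
  refine ⟨{i | Pi.single i 1 ∈ V1}, {j | Pi.single j 1 ∈ V2}, ?_,
    eq_union_quasiSector h1 h2 hcap hcup hnt1,
    eq_union_quasiSector h2 h1 (Set.inter_comm V1 V2 ▸ hcap) (Set.union_comm V1 V2 ▸ hcup) hnt2⟩
  refine Set.disjoint_left.2 fun i hi1 hi2 => ?_
  have hi : Pi.single i (1 : ℝ≥0) ∈ V1 ∩ V2 := ⟨hi1, hi2⟩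
  rw [hcap] at hi
  simp at hi
end

section
/- Let C ⊆ ℝ≥0^n be tropically convex and let y ∈ ℝ≥0^n. Then y ∈ C if and only if S_i(y) ∩ C ≠ ∅ for every i ∈ supp(y) and, in addition, S_{n+1}(y) ∩ C ≠ ∅. -/
open scoped NNReal

/-- Sector of type `i ∈ supp y` at `y`. -/
def sector {n : ℕ} (y : Fin n → ℝ≥0) (i : Fin n) : Set (Fin n → ℝ≥0) :=
  {x | (∀ j ∈ supp y, x j * y i ≤ x i * y j) ∧ y i ≤ x i ∧ ∀ j ∉ supp y, x j = 0}

/-- Sector of type `n+1` at `y`. -/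
def sectorTop {n : ℕ} (y : Fin n → ℝ≥0) : Set (Fin n → ℝ≥0) :=
  {x | ∀ j, x j ≤ y j}

/-- If `C` meets the top sector and all sectors at `y`, then for every finite set `s` of coordinates
it contains a point below `y` that agrees with `y` on `s`. -/
lemma TropConvex.exists_le_eqOn {n : ℕ} {C : Set (Fin n → ℝ≥0)} (hC : TropConvex C)
    {y : Fin n → ℝ≥0} (hsec : ∀ i ∈ supp y, (sector y i ∩ C).Nonempty)
    (htop : (sectorTop y ∩ C).Nonempty) (s : Finset (Fin n)) :
    ∃ z ∈ C, (∀ j, z j ≤ y j) ∧ ∀ j ∈ s, z j = y j := by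
  induction s using Finset.induction_on with
  | empty =>
    obtain ⟨z, hz, hzC⟩ := htop
    exact ⟨z, hzC, hz, by simp⟩
  | insert a s _ ih =>
    obtain ⟨z, hzC, hzy, hzs⟩ := ih
    by_cases ha : y a = 0
    · refine ⟨z, hzC, hzy, fun j hj => ?_⟩
      obtain rfl | hj := Finset.mem_insert.mp hj
      · exact le_antisymm (hzy j) (by simp [ha])
      · exact hzs j hj
    · obtain ⟨x, ⟨hx, hxa, hx0⟩, hxC⟩ := hsec a ha
      have hpos : 0 < x a := (pos_iff_ne_zero.mpr ha).trans_le hxa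
      have hscale : y a / x a ≤ 1 := div_le_one_of_le₀ hxa hpos.le
      have hle : ∀ j, y a / x a * x j ≤ y j := fun j => by
        by_cases hj : j ∈ supp y
        · rw [div_mul_eq_mul_div, div_le_iff₀ hpos, mul_comm (y a), mul_comm (y j)]
          exact hx j hj
        · simp [hx0 j hj]
      refine ⟨_, hC x hxC z hzC (y a / x a) 1 (max_eq_right hscale), fun j => ?_, fun j hj => ?_⟩
      · simpa using ⟨hle j, hzy j⟩
      · obtain rfl | hj := Finset.mem_insert.mp hj
        · simpa [div_mul_cancel₀ _ hpos.ne'] using hzy j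
        · simpa [hzs j hj] using hle j

theorem stmt4 {n : ℕ} (C : Set (Fin n → ℝ≥0)) (hC : TropConvex C) (y : Fin n → ℝ≥0) :
    y ∈ C ↔ (∀ i ∈ supp y, (sector y i ∩ C).Nonempty) ∧ (sectorTop y ∩ C).Nonempty := by
  constructor
  · intro hy
    refine ⟨fun i _ => ⟨y, ⟨fun j _ => (mul_comm _ _).le, le_rfl, fun j hj => ?_⟩, hy⟩,
      ⟨y, fun _ => le_rfl, hy⟩⟩
    simpa [supp] using hj
  · rintro ⟨hsec, htop⟩
    obtain ⟨z, hzC, -, hz⟩ := hC.exists_le_eqOn hsec htop Finset.univ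
    rwa [← funext fun j => hz j (Finset.mem_univ j)]
end

section
/- Let y ∈ ℝ≥0^n. A set C ⊆ ℝ≥0^n is a semispace at y — i.e., a tropically convex set not containing y that is maximal with respect to inclusion among tropically convex sets not containing y — if and only if C = ℝ≥0^n \ S_i(y) for some i ∈ supp(y) or C = ℝ≥0^n \ S_{n+1}(y). Moreover, these sets (for i ranging over supp(y) together with the index n+1) are pairwise distinct, so there are exactly |supp(y)| + 1 semispaces at y. -/
open scoped NNReal

/-- A semispace at `y`: a maximal tropically convex set not containing `y`. -/
def IsSemispace {n : ℕ} (C : Set (Fin n → ℝ≥0)) (y : Fin n → ℝ≥0) : Prop :=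
  TropConvex C ∧ y ∉ C ∧
    ∀ D : Set (Fin n → ℝ≥0), TropConvex D → y ∉ D → C ⊆ D → D = C

/-- All sectors at `y`, with `none` standing for the sector of type `n+1`. -/
def sectorFamily {n : ℕ} (y : Fin n → ℝ≥0) : Option (supp y) → Set (Fin n → ℝ≥0)
  | none => sectorTop y
  | some i => sector y i

theorem tropConvex_compl_of_left {n : ℕ} {S : Set (Fin n → ℝ≥0)}
    (h : ∀ x z : Fin n → ℝ≥0, ∀ β ≤ (1 : ℝ≥0), (fun i => max (x i) (β * z i)) ∈ S →
      x ∈ S ∨ z ∈ S) : TropConvex Sᶜ := by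
  intro x hx z hz α β hαβ hw
  rcases max_choice α β with hm | hm
  · obtain rfl : α = 1 := hm.symm.trans hαβ
    simp only [one_mul] at hw
    exact (h x z β (hαβ ▸ le_max_right _ _) hw).elim hx hz
  · obtain rfl : β = 1 := hm.symm.trans hαβ
    simp only [one_mul, max_comm (α * _)] at hw
    exact (h z x α (hαβ ▸ le_max_left _ _) hw).elim hz hx

theorem tropConvex_compl_sectorTop {n : ℕ} (y : Fin n → ℝ≥0) : TropConvex (sectorTop y)ᶜ :=
  tropConvex_compl_of_left fun _ _ _ _ hw => Or.inl fun j => (le_max_left _ _).trans (hw j)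

theorem tropConvex_compl_sector {n : ℕ} (y : Fin n → ℝ≥0) {i : Fin n} (hi : i ∈ supp y) :
    TropConvex (sector y i)ᶜ := by
  refine tropConvex_compl_of_left fun x z β hβ ⟨hle, hyi, hout⟩ => ?_
  rcases le_total (β * z i) (x i) with h | h
  · simp only [max_eq_left h] at hle hyi
    refine Or.inl ⟨fun j hj => le_trans ?_ (hle j hj), hyi, fun j hj => ?_⟩
    · gcongr
      exact le_max_left _ _
    · exact le_antisymm ((le_max_left _ _).trans (hout j hj).le) (zero_le)
  · simp only [max_eq_right h] at hle hyi
    have hβ0 : 0 < β := by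
      refine pos_of_ne_zero ?_
      rintro rfl
      exact hi (le_antisymm (by simpa using hyi) (zero_le))
    refine Or.inr ⟨fun j hj => ?_, hyi.trans (mul_le_of_le_one_left (zero_le) hβ), fun j hj => ?_⟩
    · refine le_of_mul_le_mul_left ?_ hβ0
      calc β * (z j * y i) = β * z j * y i := by ring
        _ ≤ max (x j) (β * z j) * y i := by
          gcongr
          exact le_max_right _ _
        _ ≤ β * z i * y j := hle j hj
        _ = β * (z i * y j) := by ring
    · have hz : β * z j = 0 :=
        le_antisymm ((le_max_right _ _).trans (hout j hj).le) (zero_le)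
      exact (mul_eq_zero.mp hz).resolve_left hβ0.ne'

theorem tropConvex_compl_sectorFamily {n : ℕ} (y : Fin n → ℝ≥0) (k : Option (supp y)) :
    TropConvex (sectorFamily y k)ᶜ := by
  cases k with
  | none => exact tropConvex_compl_sectorTop y
  | some i => exact tropConvex_compl_sector y i.2

theorem self_mem_sectorFamily {n : ℕ} (y : Fin n → ℝ≥0) (k : Option (supp y)) :
    y ∈ sectorFamily y k := by
  cases k with
  | none => exact fun j => le_rfl
  | some i => exact ⟨fun j _ => (mul_comm _ _).le, le_rfl, fun j hj => not_not.mp hj⟩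

theorem update_two_mul_mem_sector {n : ℕ} (y : Fin n → ℝ≥0) {i : Fin n} (hi : i ∈ supp y) :
    Function.update y i (2 * y i) ∈ sector y i := by
  have h2 : y i ≤ 2 * y i := le_mul_of_one_le_left (zero_le) one_le_two
  refine ⟨fun j _ => ?_, by simpa using h2, fun j hj => ?_⟩
  · rcases eq_or_ne j i with rfl | hji
    · simp
    · rw [Function.update_of_ne hji, Function.update_self, mul_comm]
      gcongr
  · rw [Function.update_of_ne (by rintro rfl; exact hj hi)]
    exact not_not.mp hj

theorem sectorFamily_eq_of_subset {n : ℕ} (y : Fin n → ℝ≥0) {k l : Option (supp y)}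
    (h : sectorFamily y k ⊆ sectorFamily y l) : k = l := by
  have lt_two (i : supp y) : y i < 2 * y i :=
    lt_mul_of_one_lt_left (pos_of_ne_zero i.2) one_lt_two
  rcases k with _ | i <;> rcases l with _ | j
  · rfl
  · have h0 : (0 : Fin n → ℝ≥0) ∈ sector y j := h fun _ => zero_le
    exact absurd (le_antisymm h0.2.1 (zero_le)) j.2
  · have hu := h (update_two_mul_mem_sector y i.2) i
    rw [Function.update_self] at hu
    exact absurd hu (lt_two i).not_ge
  · by_contra hij
    have hji : (j : Fin n) ≠ i := fun e => hij (by rw [Subtype.ext e])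
    have hu := (h (update_two_mul_mem_sector y i.2)).1 i i.2
    rw [Function.update_self, Function.update_of_ne hji, mul_comm (y j)] at hu
    exact absurd (le_of_mul_le_mul_right hu (pos_of_ne_zero j.2)) (lt_two i).not_ge

/-- A tropically convex set meeting every sector at `y` contains `y`. -/
theorem TropConvex.mem_of_sectorFamily_inter {n : ℕ} {y : Fin n → ℝ≥0}
    {D : Set (Fin n → ℝ≥0)} (hD : TropConvex D)
    (h : ∀ k, (D ∩ sectorFamily y k).Nonempty) : y ∈ D := by
  classical
  suffices key : ∀ s : Finset (Fin n), ∃ w ∈ D, w ∈ sectorTop y ∧ ∀ j ∈ s, w j = y j by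
    obtain ⟨w, hwD, -, hw⟩ := key Finset.univ
    exact (funext fun j => hw j (Finset.mem_univ j) : w = y) ▸ hwD
  intro s
  induction s using Finset.induction_on with
  | empty =>
    obtain ⟨w, hwD, hw⟩ := h none
    exact ⟨w, hwD, hw, by simp⟩
  | insert i s _ ih =>
    obtain ⟨w, hwD, hw, hws⟩ := ih
    by_cases hi : i ∈ supp y
    · obtain ⟨x, hxD, hxle, hyx, hxout⟩ := h (some ⟨i, hi⟩)
      have hx0 : 0 < x i := (pos_of_ne_zero hi).trans_le hyx
      have hle (j : Fin n) : y i / x i * x j ≤ y j := by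
        by_cases hj : j ∈ supp y
        · rw [div_mul_eq_mul_div, div_le_iff₀ hx0]
          simpa only [mul_comm] using hxle j hj
        · simp [hxout j hj]
      refine ⟨_, hD w hwD x hxD 1 (y i / x i) (max_eq_left (div_le_one_of_le₀ hyx (zero_le))),
        fun j => ?_, fun j hj => ?_⟩
      · simpa using ⟨hw j, hle j⟩
      · rcases Finset.mem_insert.mp hj with rfl | hj
        · simpa [div_mul_cancel₀ _ hx0.ne'] using hw j
        · simpa [hws j hj] using hle j
    · refine ⟨w, hwD, hw, fun j hj => ?_⟩
      rcases Finset.mem_insert.mp hj with rfl | hj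
      · have hy : y j = 0 := not_not.mp hi
        rw [hy]
        exact le_antisymm ((hw j).trans hy.le) (zero_le)
      · exact hws j hj

theorem TropConvex.exists_subset_compl_sectorFamily {n : ℕ} {y : Fin n → ℝ≥0}
    {D : Set (Fin n → ℝ≥0)} (hD : TropConvex D) (hy : y ∉ D) :
    ∃ k, D ⊆ (sectorFamily y k)ᶜ := by
  by_contra! h
  exact hy (hD.mem_of_sectorFamily_inter fun k => Set.inter_compl_nonempty_iff.mpr (h k)
    |>.mono (by rw [compl_compl]))

theorem isSemispace_iff_exists_sectorFamily {n : ℕ} (y : Fin n → ℝ≥0)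
    (C : Set (Fin n → ℝ≥0)) :
    IsSemispace C y ↔ ∃ k, C = (sectorFamily y k)ᶜ := by
  constructor
  · rintro ⟨hC, hy, hmax⟩
    obtain ⟨k, hk⟩ := hC.exists_subset_compl_sectorFamily hy
    exact ⟨k, (hmax _ (tropConvex_compl_sectorFamily y k)
      (fun h => h (self_mem_sectorFamily y k)) hk).symm⟩
  · rintro ⟨k, rfl⟩
    refine ⟨tropConvex_compl_sectorFamily y k, fun h => h (self_mem_sectorFamily y k),
      fun D hD hyD hsub => ?_⟩
    obtain ⟨l, hl⟩ := hD.exists_subset_compl_sectorFamily hyD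
    obtain rfl := sectorFamily_eq_of_subset y (Set.compl_subset_compl.mp (hsub.trans hl))
    exact hl.antisymm hsub

theorem compl_sectorFamily_injective {n : ℕ} (y : Fin n → ℝ≥0) :
    Function.Injective fun k => (sectorFamily y k)ᶜ :=
  fun _ _ h => sectorFamily_eq_of_subset y (compl_injective h).subset

theorem stmt5 {n : ℕ} (y : Fin n → ℝ≥0) :
    (∀ C : Set (Fin n → ℝ≥0),
      IsSemispace C y ↔ ((∃ i ∈ supp y, C = (sector y i)ᶜ) ∨ C = (sectorTop y)ᶜ)) ∧
    (∀ i ∈ supp y, ∀ j ∈ supp y, (sector y i)ᶜ = (sector y j)ᶜ → i = j) ∧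
    (∀ i ∈ supp y, (sector y i)ᶜ ≠ (sectorTop y)ᶜ) := by
  refine ⟨fun C => ?_, fun i hi j hj h => ?_, fun i hi h => ?_⟩
  · rw [isSemispace_iff_exists_sectorFamily, Option.exists, or_comm, Subtype.exists]
    simp only [sectorFamily, exists_prop]
  · have := @compl_sectorFamily_injective n y (some ⟨i, hi⟩) (some ⟨j, hj⟩) h
    simpa using this
  · have := @compl_sectorFamily_injective n y (some ⟨i, hi⟩) none h
    simp at this
end

section
/- Let (H1, H2) be a complementary pair of hemispaces in ℝ≥0^n. Then there exist disjoint subsets I, J of {1,…,n+1} such that H1 = ⋃{S_i(y) : y ∈ H1, i ∈ I ∩ (supp(y) ∪ {n+1}), S_i(y) ⊆ H1} and H2 = ⋃{S_j(y) : y ∈ H2, j ∈ J ∩ (supp(y) ∪ {n+1}), S_j(y) ⊆ H2}. -/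
open scoped NNReal

/-- Combined sector indexed by `Option (Fin n)`: `some i` is the sector of type `i`,
`none` is the sector of type `n+1`. -/
def sectorIdx {n : ℕ} (y : Fin n → ℝ≥0) : Option (Fin n) → Set (Fin n → ℝ≥0)
  | some i => sector y i
  | none => sectorTop y

/-- Validity of an index for a base point `y`: `some i` requires `i ∈ supp y`,
the extra index `n+1` (here `none`) is always valid. -/
def validIdx {n : ℕ} (y : Fin n → ℝ≥0) : Option (Fin n) → Prop
  | some i => i ∈ supp y
  | none => True

/-- A point belongs to a tropically convex set that meets all sectors based at that point. -/
theorem TropConvex.mem_of_forall_sectorIdx {n : ℕ} {C : Set (Fin n → ℝ≥0)} (hC : TropConvex C)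
    {x : Fin n → ℝ≥0} (h : ∀ k, validIdx x k → ∃ z ∈ sectorIdx x k, z ∈ C) : x ∈ C := by
  have key : ∀ s : Finset (Fin n), ∃ w ∈ C, w ≤ x ∧ ∀ k ∈ s, x k ≤ w k := by
    intro s
    induction s using Finset.induction_on with
    | empty =>
      obtain ⟨z, hz, hzC⟩ := h none trivial
      exact ⟨z, hzC, hz, by simp⟩
    | insert k s _ ih =>
      obtain ⟨w, hwC, hwx, hws⟩ := ih
      by_cases hk : x k = 0
      · exact ⟨w, hwC, hwx, by simpa [hk] using hws⟩
      obtain ⟨z, ⟨hz, hkz, hz0⟩, hzC⟩ := h (some k) hk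
      have hzk : 0 < z k := (pos_iff_ne_zero.2 hk).trans_le hkz
      refine ⟨_, hC w hwC z hzC 1 (x k / z k) (max_eq_left (div_le_one_of_le₀ hkz zero_le)),
        fun j => ?_, fun j hj => ?_⟩
      · refine max_le (by simpa using hwx j) ?_
        by_cases hj : x j = 0
        · simp [hz0 j (by simpa [supp] using hj)]
        · rw [div_mul_eq_mul_div, div_le_iff₀ hzk, mul_comm (x k), mul_comm (x j)]
          exact hz j hj
      · rcases Finset.mem_insert.1 hj with rfl | hj
        · simp [div_mul_cancel₀ _ hzk.ne']
        · simpa using Or.inl (hws j hj)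
  obtain ⟨w, hwC, hwx, hw⟩ := key Finset.univ
  rwa [← le_antisymm hwx fun k => hw k (Finset.mem_univ k)]

theorem self_mem_sectorIdx {n : ℕ} (x : Fin n → ℝ≥0) (k : Option (Fin n)) :
    x ∈ sectorIdx x k := by
  cases k with
  | none => exact fun _ => le_rfl
  | some i => exact ⟨fun j _ => (mul_comm _ _).le, le_rfl, fun j hj => by simpa [supp] using hj⟩

/-- Two sectors of the same type always intersect. -/
theorem sectorIdx_inter_nonempty {n : ℕ} {x y : Fin n → ℝ≥0} {k : Option (Fin n)}
    (hx : validIdx x k) (hy : validIdx y k) : (sectorIdx x k ∩ sectorIdx y k).Nonempty := by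
  cases k with
  | none => exact ⟨0, fun _ => zero_le, fun _ => zero_le⟩
  | some i =>
    have single_mem {u : Fin n → ℝ≥0} {c : ℝ≥0} (hu : i ∈ supp u) (hc : u i ≤ c) :
        Pi.single i c ∈ sector u i := by
      refine ⟨fun j _ => ?_, by simpa using hc, fun j hj => ?_⟩
      · obtain rfl | hji := eq_or_ne j i
        · exact le_rfl
        · simp [hji]
      · have hji : j ≠ i := by rintro rfl; exact hj hu
        simp [hji]
    exact ⟨Pi.single i (max (x i) (y i)), single_mem hx (le_max_left _ _),
      single_mem hy (le_max_right _ _)⟩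

/-- If the complement of `H` is tropically convex, then `H` is the union of the sectors it contains
that are based at points of `H`. -/
theorem eq_iUnion_sectorIdx {n : ℕ} {H : Set (Fin n → ℝ≥0)} (hH : TropConvex Hᶜ) :
    H = {x | ∃ y ∈ H, ∃ k ∈ {k | ∃ y ∈ H, validIdx y k ∧ sectorIdx y k ⊆ H},
      validIdx y k ∧ sectorIdx y k ⊆ H ∧ x ∈ sectorIdx y k} := by
  ext x
  constructor
  · intro hx
    obtain ⟨k, hk, hkH⟩ : ∃ k, validIdx x k ∧ sectorIdx x k ⊆ H := by
      by_contra! hcon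
      exact hH.mem_of_forall_sectorIdx (fun k hk => Set.not_subset.1 (hcon k hk)) hx
    exact ⟨x, hx, k, ⟨x, hx, hk, hkH⟩, hk, hkH, self_mem_sectorIdx x k⟩
  · rintro ⟨y, _, k, _, _, hsub, hx⟩
    exact hsub hx

theorem stmt7 {n : ℕ} (H1 H2 : Set (Fin n → ℝ≥0))
    (h1 : TropConvex H1) (h2 : TropConvex H2)
    (hcap : H1 ∩ H2 = ∅) (hcup : H1 ∪ H2 = Set.univ) :
    ∃ I J : Set (Option (Fin n)), Disjoint I J ∧
      H1 = {x | ∃ y ∈ H1, ∃ k ∈ I, validIdx y k ∧ sectorIdx y k ⊆ H1 ∧ x ∈ sectorIdx y k} ∧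
      H2 = {x | ∃ y ∈ H2, ∃ k ∈ J, validIdx y k ∧ sectorIdx y k ⊆ H2 ∧ x ∈ sectorIdx y k} := by
  have hcompl : IsCompl H1 H2 :=
    ⟨Set.disjoint_iff_inter_eq_empty.2 hcap, codisjoint_iff.2 hcup⟩
  refine ⟨_, _, ?_, eq_iUnion_sectorIdx (hcompl.compl_eq ▸ h2),
    eq_iUnion_sectorIdx (hcompl.symm.compl_eq ▸ h1)⟩
  refine Set.disjoint_left.2 ?_
  rintro k ⟨x, _, hxk, hx⟩ ⟨y, _, hyk, hy⟩
  obtain ⟨z, hzx, hzy⟩ := sectorIdx_inter_nonempty hxk hyk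
  exact Set.disjoint_left.1 hcompl.disjoint (hx hzx) (hy hzy)
end

section
/- Let y ∈ ℝ≥0^n with y ≠ 0 and let i ∈ supp(y). Then: (a) W_i(y) = cone({e^i ⊕ (y_j·y_i⁻¹)·e^j : j ∈ supp(y)}); (b) S_i(y) = {y_i·e^i} ⊕ cone({e^i ⊕ (y_j·y_i⁻¹)·e^j : j ∈ supp(y)}); (c) S_{n+1}(y) = conv({0} ∪ {y_j·e^j : j ∈ supp(y)}). Here e^i ⊕ (y_j·y_i⁻¹)·e^j denotes the vector with i-th coordinate 1, j-th coordinate y_j/y_i, and all other coordinates 0 (it equals e^i when j = i). -/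
open scoped NNReal

/-- The `i`-th unit vector. -/
def unitVec {n : ℕ} (i : Fin n) : Fin n → ℝ≥0 := fun k => if k = i then 1 else 0

/-- The vector `e^i ⊕ λ e^j` (i-th coordinate `max 1 (λ·[i=j])`, j-th coordinate `λ`). -/
def duet {n : ℕ} (i j : Fin n) (lam : ℝ≥0) : Fin n → ℝ≥0 :=
  fun k => max (unitVec i k) (lam * unitVec j k)

/-- Tropical linear span (cone generated by `R`): all finite tropical linear combinations. -/
def tropSpan {n : ℕ} (R : Set (Fin n → ℝ≥0)) : Set (Fin n → ℝ≥0) :=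
  {x | ∃ (m : ℕ) (r : Fin m → Fin n → ℝ≥0) (l : Fin m → ℝ≥0),
    (∀ k, r k ∈ R) ∧ x = fun i => Finset.univ.sup fun k => l k * r k i}

/-- Tropical convex hull: all finite tropical convex combinations. -/
def tropConv {n : ℕ} (P : Set (Fin n → ℝ≥0)) : Set (Fin n → ℝ≥0) :=
  {x | ∃ (m : ℕ) (p : Fin m → Fin n → ℝ≥0) (l : Fin m → ℝ≥0),
    (∀ k, p k ∈ P) ∧ Finset.univ.sup l = 1 ∧
    x = fun i => Finset.univ.sup fun k => l k * p k i}

/-- Tropical Minkowski sum of two sets. -/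
def tropMink {n : ℕ} (A B : Set (Fin n → ℝ≥0)) : Set (Fin n → ℝ≥0) :=
  {z | ∃ a ∈ A, ∃ b ∈ B, z = fun i => max (a i) (b i)}

/-- A scalar multiple of the generator `e^i ⊕ (y_j / y_i) e^j`, written so that its `j`-th
coordinate is at least `a`. -/
theorem mul_duet_apply {n : ℕ} {y : Fin n → ℝ≥0} {i j : Fin n} (hi : y i ≠ 0) (hj : y j ≠ 0)
    (a : ℝ≥0) (c : Fin n) :
    a * y i * (y j)⁻¹ * duet i j (y j * (y i)⁻¹) c =
      max (if c = i then a * y i * (y j)⁻¹ else 0) (if c = j then a else 0) := by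
  have h : a * y i * (y j)⁻¹ * (y j * (y i)⁻¹) = a := by field_simp
  simp only [duet, unitVec, mul_max, ← mul_assoc]
  rw [mul_assoc (a * y i * (y j)⁻¹), h]
  simp only [mul_ite, mul_one, mul_zero]

theorem duet_mem_quasiSector {n : ℕ} {y : Fin n → ℝ≥0} {i j : Fin n} (hi : i ∈ supp y)
    (hj : j ∈ supp y) : duet i j (y j * (y i)⁻¹) ∈ quasiSector y i := by
  have hi' : y i ≠ 0 := hi
  refine ⟨fun k _ => ?_, fun k hk => ?_⟩
  · have h1 : 1 ≤ duet i j (y j * (y i)⁻¹) i := by simp [duet, unitVec]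
    refine le_trans ?_ (le_mul_of_one_le_left (zero_le (a := y k)) h1)
    simp only [duet, unitVec, max_mul]
    refine max_le ?_ ?_
    · split_ifs with h <;> simp [h]
    · split_ifs with h
      · subst h; simp [hi']
      · simp
  · have h1 : k ≠ i := fun h => hk (h ▸ hi)
    have h2 : k ≠ j := fun h => hk (h ▸ hj)
    simp [duet, unitVec, h1, h2]

theorem tropSpan_subset_quasiSector {n : ℕ} {y : Fin n → ℝ≥0} {i : Fin n}
    {R : Set (Fin n → ℝ≥0)} (hR : R ⊆ quasiSector y i) : tropSpan R ⊆ quasiSector y i := by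
  rintro x ⟨m, r, l, hr, rfl⟩
  refine ⟨fun j hj => ?_, fun j hj => ?_⟩
  · simp only [NNReal.finset_sup_mul]
    refine Finset.sup_mono_fun fun k _ => ?_
    simp only [mul_assoc]
    exact mul_le_mul_right ((hR (hr k)).1 j hj) _
  · simp [(hR (hr _)).2 j hj]

theorem quasiSector_subset_tropSpan {n : ℕ} {y : Fin n → ℝ≥0} {i : Fin n} (hi : i ∈ supp y) :
    quasiSector y i ⊆ tropSpan {v | ∃ j ∈ supp y, v = duet i j (y j * (y i)⁻¹)} := by
  classical
  rintro x ⟨hx, hx0⟩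
  refine ⟨n, fun k => if k ∈ supp y then duet i k (y k * (y i)⁻¹) else
    duet i i (y i * (y i)⁻¹), fun k => x k * y i * (y k)⁻¹, fun k => ?_, ?_⟩
  · dsimp only
    split_ifs with h
    · exact ⟨k, h, rfl⟩
    · exact ⟨i, hi, rfl⟩
  funext c
  refine le_antisymm ?_ (Finset.sup_le fun k _ => ?_)
  · by_cases hc : c ∈ supp y
    · refine le_trans ?_ (Finset.le_sup (Finset.mem_univ c))
      simp only [if_pos hc]
      rw [mul_duet_apply hi hc]
      simp
    · simp [hx0 c hc]
  · by_cases hk : k ∈ supp y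
    · have hk' : y k ≠ 0 := hk
      simp only [if_pos hk]
      rw [mul_duet_apply hi hk]
      refine max_le ?_ ?_
      · split_ifs with h
        · subst h
          rw [← div_eq_mul_inv]
          exact div_le_of_le_mul₀ zero_le zero_le (hx k hk)
        · exact zero_le
      · split_ifs with h
        · rw [h]
        · exact zero_le
    · simp [hx0 k hk]

theorem quasiSector_eq_tropSpan {n : ℕ} {y : Fin n → ℝ≥0} {i : Fin n} (hi : i ∈ supp y) :
    quasiSector y i = tropSpan {v | ∃ j ∈ supp y, v = duet i j (y j * (y i)⁻¹)} := by
  refine (quasiSector_subset_tropSpan hi).antisymm (tropSpan_subset_quasiSector ?_)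
  rintro _ ⟨j, hj, rfl⟩
  exact duet_mem_quasiSector hi hj

theorem sector_eq_tropMink {n : ℕ} {y : Fin n → ℝ≥0} {i : Fin n} (hi : i ∈ supp y) :
    sector y i = tropMink {fun k => y i * unitVec i k} (quasiSector y i) := by
  ext x
  constructor
  · rintro ⟨hx, hix, hx0⟩
    refine ⟨_, rfl, x, ⟨hx, hx0⟩, ?_⟩
    funext c
    refine (max_eq_right ?_).symm
    by_cases h : c = i
    · simpa [unitVec, h] using hix
    · simp [unitVec, h]
  · rintro ⟨_, rfl, b, ⟨hb, hb0⟩, rfl⟩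
    refine ⟨fun j hj => ?_, by simp [unitVec], fun j hj => ?_⟩
    · by_cases h : j = i
      · simp [h]
      · simpa [unitVec, h, max_mul] using Or.inr (hb j hj)
    · have h : j ≠ i := fun h => hj (h ▸ hi)
      simp [unitVec, h, hb0 j hj]

theorem sectorTop_eq_tropConv {n : ℕ} (y : Fin n → ℝ≥0) :
    sectorTop y = tropConv ({0} ∪ {v | ∃ j ∈ supp y, v = fun k => y j * unitVec j k}) := by
  ext x
  constructor
  · intro hx
    have hl (j : Fin n) : x j * (y j)⁻¹ * y j = x j := by
      by_cases h : y j = 0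
      · have hxj := hx j
        rw [h] at hxj
        simp [nonpos_iff_eq_zero.mp hxj]
      · field_simp
    refine ⟨n + 1, Fin.cons 0 fun j k => y j * unitVec j k, Fin.cons 1 fun j => x j * (y j)⁻¹,
      ?_, ?_, ?_⟩
    · refine Fin.cases (Or.inl rfl) fun j => ?_
      by_cases h : y j = 0
      · left
        funext k
        simp [h]
      · exact Or.inr ⟨j, h, rfl⟩
    · refine le_antisymm (Finset.sup_le fun k _ => ?_)
        (Finset.le_sup (f := Fin.cons 1 fun j => x j * (y j)⁻¹) (Finset.mem_univ 0))
      refine Fin.cases le_rfl (fun j => ?_) k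
      rw [Fin.cons_succ, ← div_eq_mul_inv]
      exact div_le_one_of_le₀ (hx j) zero_le
    · funext c
      refine le_antisymm ?_ (Finset.sup_le fun k _ => ?_)
      · refine le_trans ?_ (Finset.le_sup (Finset.mem_univ c.succ))
        simp [unitVec, hl]
      · refine Fin.cases (by simp) (fun j => ?_) k
        simp only [Fin.cons_succ, ← mul_assoc, hl, unitVec]
        split_ifs with h
        · simp [h]
        · simp
  · rintro ⟨m, p, l, hp, hl, rfl⟩ c
    refine Finset.sup_le fun k _ => ?_
    have hlk : l k ≤ 1 := hl ▸ Finset.le_sup (Finset.mem_univ k)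
    refine (mul_le_of_le_one_left zero_le hlk).trans ?_
    rcases hp k with h | ⟨j, _, h⟩
    · rw [Set.mem_singleton_iff.mp h]
      exact zero_le
    · rw [h]
      by_cases hc : c = j <;> simp [unitVec, hc]

theorem stmt8 {n : ℕ} (y : Fin n → ℝ≥0) (hy : y ≠ 0) (i : Fin n) (hi : i ∈ supp y) :
    quasiSector y i = tropSpan {v | ∃ j ∈ supp y, v = duet i j (y j * (y i)⁻¹)} ∧
    sector y i = tropMink {fun k => y i * unitVec i k}
        (tropSpan {v | ∃ j ∈ supp y, v = duet i j (y j * (y i)⁻¹)}) ∧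
    sectorTop y = tropConv ({0} ∪ {v | ∃ j ∈ supp y, v = fun k => y j * unitVec j k}) := by
  refine ⟨quasiSector_eq_tropSpan hi, ?_, sectorTop_eq_tropConv y⟩
  rw [← quasiSector_eq_tropSpan hi]
  exact sector_eq_tropMink hi
end

section
/- Let U ⊆ ℝ≥0^{n+1} and set V := cone(U) ⊆ ℝ≥0^{n+1}. Suppose the coordinate section C^1_V is nonempty. Define P_U := {y ∈ ℝ≥0^n : there exists μ ∈ ℝ≥0, μ ≠ 0, with (μy, μ) ∈ U} and R_U := {z ∈ ℝ≥0^n : (z, 0) ∈ U}. Then C^1_V = conv(P_U) ⊕ cone(R_U). -/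
open scoped NNReal

/-- Coordinate section of `V ⊆ ℝ≥0^{n+1}` by `x_{n+1} = α`. -/
def coordSection {n : ℕ} (V : Set (Fin (n+1) → ℝ≥0)) (α : ℝ≥0) : Set (Fin n → ℝ≥0) :=
  {x | Fin.snoc x α ∈ V}

theorem sup_univ_comp_equiv {ι κ : Type*} [Fintype ι] [Fintype κ] (e : ι ≃ κ) (f : κ → ℝ≥0) :
    (Finset.univ.sup fun k => f (e k)) = Finset.univ.sup f := by
  rw [← Finset.map_univ_equiv e, Finset.sup_map]
  rfl

theorem sup_univ_sum {ι κ : Type*} [Fintype ι] [Fintype κ] (f : ι ⊕ κ → ℝ≥0) :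
    Finset.univ.sup f =
      max (Finset.univ.sup fun k => f (Sum.inl k)) (Finset.univ.sup fun k => f (Sum.inr k)) := by
  rw [← Finset.univ_disjSum_univ, Finset.sup_disjSum]

theorem sup_univ_eq_max_subtype {ι : Type*} [Fintype ι] (p : ι → Prop) [DecidablePred p]
    (f : ι → ℝ≥0) :
    Finset.univ.sup f =
      max (Finset.univ.sup fun k : {k // p k} => f k)
        (Finset.univ.sup fun k : {k // ¬p k} => f k) := by
  rw [← sup_univ_comp_equiv (Equiv.sumCompl p) f, sup_univ_sum]
  simp

theorem sup_mem_tropSpan {n : ℕ} {ι : Type*} [Fintype ι] {R : Set (Fin n → ℝ≥0)}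
    (r : ι → Fin n → ℝ≥0) (l : ι → ℝ≥0) (hr : ∀ k, r k ∈ R) :
    (fun i => Finset.univ.sup fun k => l k * r k i) ∈ tropSpan R := by
  refine ⟨Fintype.card ι, fun k => r ((Fintype.equivFin ι).symm k),
    fun k => l ((Fintype.equivFin ι).symm k), fun k => hr _, ?_⟩
  funext i
  exact (sup_univ_comp_equiv (Fintype.equivFin ι).symm fun k => l k * r k i).symm

theorem sup_mem_tropConv {n : ℕ} {ι : Type*} [Fintype ι] {P : Set (Fin n → ℝ≥0)}
    (p : ι → Fin n → ℝ≥0) (l : ι → ℝ≥0) (hp : ∀ k, p k ∈ P) (hl : Finset.univ.sup l = 1) :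
    (fun i => Finset.univ.sup fun k => l k * p k i) ∈ tropConv P := by
  refine ⟨Fintype.card ι, fun k => p ((Fintype.equivFin ι).symm k),
    fun k => l ((Fintype.equivFin ι).symm k), fun k => hp _, ?_, ?_⟩
  · rw [sup_univ_comp_equiv (Fintype.equivFin ι).symm l, hl]
  · funext i
    exact (sup_univ_comp_equiv (Fintype.equivFin ι).symm fun k => l k * p k i).symm

theorem stmt10 {n : ℕ} (U : Set (Fin (n+1) → ℝ≥0))
    (hne : (coordSection (tropSpan U) 1).Nonempty) :
    coordSection (tropSpan U) 1 =
      tropMink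
        (tropConv {y : Fin n → ℝ≥0 | ∃ μ : ℝ≥0, μ ≠ 0 ∧ Fin.snoc (fun i => μ * y i) μ ∈ U})
        (tropSpan {z : Fin n → ℝ≥0 | Fin.snoc z 0 ∈ U}) := by
  classical
  ext x
  constructor
  · rintro ⟨m, r, l, hr, hx⟩
    have hcoord (i : Fin n) : x i = Finset.univ.sup fun k => l k * r k i.castSucc := by
      simpa using congrFun hx i.castSucc
    have hlast : 1 = Finset.univ.sup fun k => l k * r k (Fin.last n) := by
      simpa using congrFun hx (Fin.last n)
    rw [sup_univ_eq_max_subtype fun k => r k (Fin.last n) ≠ 0] at hlast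
    have hzero : (Finset.univ.sup fun k : {k // ¬r k (Fin.last n) ≠ 0} =>
        l k * r k (Fin.last n)) = 0 := by
      refine le_antisymm (Finset.sup_le fun k _ => ?_) zero_le
      rw [not_not.mp k.2, mul_zero]
    rw [hzero, max_eq_left zero_le] at hlast
    refine ⟨_, sup_mem_tropConv
        (fun (k : {k // r k (Fin.last n) ≠ 0}) i => r k i.castSucc / r k (Fin.last n))
        (fun k => l k * r k (Fin.last n)) (fun k => ⟨r k (Fin.last n), k.2, ?_⟩) hlast.symm,
      _, sup_mem_tropSpan
        (fun (k : {k // ¬r k (Fin.last n) ≠ 0}) i => r k i.castSucc)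
        (fun k => l k) (fun k => ?_), ?_⟩
    · convert hr k using 1
      simp only [mul_div_cancel₀ _ k.2]
      exact Fin.snoc_init_self (r k)
    · have hk := hr k
      rw [← Fin.snoc_init_self (r k), not_not.mp k.2] at hk
      exact hk
    · funext i
      rw [hcoord, sup_univ_eq_max_subtype fun k => r k (Fin.last n) ≠ 0]
      congr 2
      funext k
      rw [mul_assoc, mul_div_cancel₀ _ k.2]
  · rintro ⟨_, ⟨m, p, l, hp, hl, rfl⟩, _, ⟨m', z, l', hz, rfl⟩, rfl⟩
    choose μ hμ hU using hp
    have key := sup_mem_tropSpan (R := U)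
      (Sum.elim (fun k => Fin.snoc (fun i => μ k * p k i) (μ k)) (fun k => Fin.snoc (z k) 0))
      (Sum.elim (fun k => l k / μ k) l') (by rintro (k | k); exacts [hU k, hz k])
    change Fin.snoc _ _ ∈ tropSpan U
    convert key using 1
    funext i
    rw [sup_univ_sum]
    refine Fin.lastCases ?_ (fun i => ?_) i
    · simp [hμ, hl]
    · simp [← mul_assoc, hμ]
end

section
/- Let s_{11}, s_{12}, s_{21}, s_{22} ∈ (0,∞), and for k, l ∈ {1,2} let A_{kl} ⊆ [0,∞] be equal either to {λ ∈ ℝ≥0 : λ ≤ s_{kl}} or to {λ ∈ ℝ≥0 : λ < s_{kl}}; set B_{kl} := [0,∞] \ A_{kl}. If (B_{12}·B_{21}) ∩ (A_{11}·A_{22}) = ∅ and (A_{12}·A_{21}) ∩ (B_{11}·B_{22}) = ∅, then s_{11}·s_{22} = s_{12}·s_{21}. -/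
open scoped NNReal ENNReal Pointwise

theorem NNReal.exists_mul_eq_mul_of_mul_lt_mul {a b c d : ℝ≥0} (ha : 0 < a) (hb : 0 < b)
    (h : a * b < c * d) :
    ∃ x y u v : ℝ≥0, a < x ∧ b < y ∧ u < c ∧ v < d ∧ x * y = u * v := by
  have hab : 0 < a * b := mul_pos ha hb
  have hcd : 0 < c * d := hab.trans h
  have hc : 0 < c := pos_of_mul_pos_left hcd zero_le
  have hd : 0 < d := pos_of_mul_pos_right hcd zero_le
  obtain ⟨t, ht⟩ : ∃ t : ℝ≥0, t ^ 4 = c * d / (a * b) :=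
    ⟨NNReal.sqrt (NNReal.sqrt (c * d / (a * b))), by
      rw [show 4 = 2 * 2 from rfl, pow_mul, NNReal.sq_sqrt, NNReal.sq_sqrt]⟩
  have ht1 : 1 < t := by
    have h4 : 1 < t ^ 4 := by rw [ht]; exact (one_lt_div hab).2 h
    exact lt_of_not_ge fun hle => h4.not_ge (pow_le_one₀ zero_le hle)
  have ht0 : 0 < t := one_pos.trans ht1
  refine ⟨a * t, b * t, c / t, d / t, lt_mul_of_one_lt_right ha ht1,
    lt_mul_of_one_lt_right hb ht1, div_lt_self hc ht1, div_lt_self hd ht1, ?_⟩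
  have hkey : t ^ 4 * (a * b) = c * d := by rw [ht, div_mul_cancel₀ _ hab.ne']
  rw [div_mul_div_comm, eq_div_iff (mul_pos ht0 ht0).ne', ← hkey]
  ring

theorem ENNReal.mul_inter_mul_nonempty_of_mul_lt_mul {a b c d : ℝ≥0} (ha : 0 < a) (hb : 0 < b)
    (h : a * b < c * d) {P Q R S : Set ℝ≥0∞} (hP : Set.Ioi (a : ℝ≥0∞) ⊆ P)
    (hQ : Set.Ioi (b : ℝ≥0∞) ⊆ Q) (hR : Set.Iio (c : ℝ≥0∞) ⊆ R)
    (hS : Set.Iio (d : ℝ≥0∞) ⊆ S) : ((P * Q) ∩ (R * S)).Nonempty := by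
  obtain ⟨x, y, u, v, hx, hy, hu, hv, hxy⟩ := NNReal.exists_mul_eq_mul_of_mul_lt_mul ha hb h
  refine ⟨(x : ℝ≥0∞) * y, Set.mul_mem_mul (hP (ENNReal.coe_lt_coe.2 hx))
    (hQ (ENNReal.coe_lt_coe.2 hy)), ?_⟩
  rw [← ENNReal.coe_mul, hxy, ENNReal.coe_mul]
  exact Set.mul_mem_mul (hR (ENNReal.coe_lt_coe.2 hu)) (hS (ENNReal.coe_lt_coe.2 hv))

theorem Set.Iio_subset_and_Ioi_subset_compl {α : Type*} [LinearOrder α] {s : α} {A : Set α}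
    (hA : A = {l | l ≤ s} ∨ A = {l | l < s}) : Set.Iio s ⊆ A ∧ Set.Ioi s ⊆ Aᶜ := by
  rcases hA with rfl | rfl
  · exact ⟨fun _ hx => le_of_lt hx, fun _ hx => not_le_of_gt hx⟩
  · exact ⟨fun _ hx => hx, fun _ hx => lt_asymm hx⟩

theorem stmt15 (s11 s12 s21 s22 : ℝ≥0)
    (h11 : 0 < s11) (h12 : 0 < s12) (h21 : 0 < s21) (h22 : 0 < s22)
    (A11 A12 A21 A22 : Set ℝ≥0∞)
    (hA11 : A11 = {l | l ≤ (s11 : ℝ≥0∞)} ∨ A11 = {l | l < (s11 : ℝ≥0∞)})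
    (hA12 : A12 = {l | l ≤ (s12 : ℝ≥0∞)} ∨ A12 = {l | l < (s12 : ℝ≥0∞)})
    (hA21 : A21 = {l | l ≤ (s21 : ℝ≥0∞)} ∨ A21 = {l | l < (s21 : ℝ≥0∞)})
    (hA22 : A22 = {l | l ≤ (s22 : ℝ≥0∞)} ∨ A22 = {l | l < (s22 : ℝ≥0∞)})
    (h1 : (A12ᶜ * A21ᶜ) ∩ (A11 * A22) = ∅)
    (h2 : (A12 * A21) ∩ (A11ᶜ * A22ᶜ) = ∅) :
    s11 * s22 = s12 * s21 := by
  obtain ⟨l11, u11⟩ := Set.Iio_subset_and_Ioi_subset_compl hA11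
  obtain ⟨l12, u12⟩ := Set.Iio_subset_and_Ioi_subset_compl hA12
  obtain ⟨l21, u21⟩ := Set.Iio_subset_and_Ioi_subset_compl hA21
  obtain ⟨l22, u22⟩ := Set.Iio_subset_and_Ioi_subset_compl hA22
  rcases lt_trichotomy (s11 * s22) (s12 * s21) with h | h | h
  · rw [Set.inter_comm] at h2
    exact absurd h2
      (ENNReal.mul_inter_mul_nonempty_of_mul_lt_mul h11 h22 h u11 u22 l12 l21).ne_empty
  · exact h
  · exact absurd h1
      (ENNReal.mul_inter_mul_nonempty_of_mul_lt_mul h12 h21 h u12 u21 l11 l22).ne_empty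
end

section
/- A set V ⊆ ℝ≥0^n is simultaneously closed (in the product topology) and a conical hemispace if and only if there exist pairwise disjoint subsets I, J, L of {1,…,n} and coefficients β_i ∈ (0,∞) for i ∈ I and γ_j ∈ (0,∞) for j ∈ J such that V = {x ∈ ℝ≥0^n : max_{j∈J} γ_j·x_j ≤ max_{i∈I} β_i·x_i and x_i = 0 for all i ∈ L}, where a maximum over the empty index set is 0. -/
open scoped NNReal

/-- A conical hemispace: a tropical cone whose complement, enlarged with `0`, is also a
tropical cone. -/
def IsConicalHemispace {n : ℕ} (V : Set (Fin n → ℝ≥0)) : Prop :=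
  TropCone V ∧ ∃ V2 : Set (Fin n → ℝ≥0), TropCone V2 ∧ V ∩ V2 = {0} ∧ V ∪ V2 = Set.univ


namespace TropCone

variable {n : ℕ} {V : Set (Fin n → ℝ≥0)}

lemma sup_mem_s16 (hV : TropCone V) {x y : Fin n → ℝ≥0} (hx : x ∈ V) (hy : y ∈ V) : x ⊔ y ∈ V :=
  hV.2.1 x hx y hy

lemma smul_mem (hV : TropCone V) {x : Fin n → ℝ≥0} (c : ℝ≥0) (hx : x ∈ V) : c • x ∈ V :=
  hV.2.2 x hx c

lemma zero_mem_s16 (hV : TropCone V) : (0 : Fin n → ℝ≥0) ∈ V := by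
  obtain ⟨x, hx⟩ := hV.1
  simpa using hV.smul_mem 0 hx

/-- A vector lies in a tropical cone as soon as each of its coordinates is attained by an element
of the cone below it. -/
lemma mem_of_forall_exists_le (hV : TropCone V) {x : Fin n → ℝ≥0}
    (h : ∀ k, ∃ y ∈ V, y ≤ x ∧ y k = x k) : x ∈ V := by
  choose y hyV hyx hy using h
  have hx : x = Finset.univ.sup y := by
    refine le_antisymm (fun k => ?_) (Finset.sup_le fun k _ => hyx k)
    rw [← hy k]
    exact Finset.le_sup (f := y) (Finset.mem_univ k) k
  rw [hx]
  exact Finset.sup_induction hV.zero_mem_s16 (fun a ha b hb => hV.sup_mem_s16 ha hb) fun k _ => hyV k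

lemma single_mem (hV : TropCone V) {i : Fin n} (hi : Pi.single i (1 : ℝ≥0) ∈ V) (a : ℝ≥0) :
    Pi.single i a ∈ V := by
  simpa [← Pi.single_smul] using hV.smul_mem a hi

end TropCone

section Pairs

variable {n : ℕ}

/-- The vector with tropical expansion `a e^i ⊕ b e^j`. -/
def pairVec (i : Fin n) (a : ℝ≥0) (j : Fin n) (b : ℝ≥0) : Fin n → ℝ≥0 :=
  Pi.single i a ⊔ Pi.single j b

lemma smul_pairVec (c : ℝ≥0) (i : Fin n) (a : ℝ≥0) (j : Fin n) (b : ℝ≥0) :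
    c • pairVec i a j b = pairVec i (c * a) j (c * b) := by
  funext k
  simp only [pairVec, Pi.smul_apply, Pi.sup_apply, Pi.single_apply, smul_eq_mul]
  rw [mul_max]
  split_ifs <;> simp

lemma single_le_of_le_apply {i : Fin n} {a : ℝ≥0} {x : Fin n → ℝ≥0} (h : a ≤ x i) :
    Pi.single i a ≤ x := by
  intro k
  rcases eq_or_ne k i with rfl | hk
  · simpa using h
  · simp [hk]

lemma pairVec_apply_le (i j : Fin n) (x : Fin n → ℝ≥0) : pairVec i (x i) j (x j) ≤ x :=
  sup_le (single_le_of_le_apply le_rfl) (single_le_of_le_apply le_rfl)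

lemma pairVec_apply_left (i j : Fin n) (x : Fin n → ℝ≥0) : pairVec i (x i) j (x j) i = x i :=
  le_antisymm (pairVec_apply_le i j x i) (by simp [pairVec])

lemma pairVec_apply_right (i j : Fin n) (x : Fin n → ℝ≥0) : pairVec i (x i) j (x j) j = x j :=
  le_antisymm (pairVec_apply_le i j x j) (by simp [pairVec])

lemma continuous_pairVec (i j : Fin n) :
    Continuous fun p : ℝ≥0 × ℝ≥0 => pairVec i p.1 j p.2 := by
  refine continuous_pi fun k => ?_
  simp only [pairVec, Pi.sup_apply, Pi.single_apply]
  refine Continuous.sup ?_ ?_ <;> split_ifs <;> fun_prop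

lemma pairVec_ne_zero_right {i j : Fin n} {a b : ℝ≥0} (hb : b ≠ 0) : pairVec i a j b ≠ 0 := by
  intro h
  have := congrFun h j
  simp [pairVec, hb] at this

lemma pairVec_ne_zero_left {i j : Fin n} {a b : ℝ≥0} (ha : a ≠ 0) : pairVec i a j b ≠ 0 := by
  intro h
  have := congrFun h i
  simp [pairVec, ha] at this

end Pairs

section Hemispace

variable {n : ℕ} {V : Set (Fin n → ℝ≥0)}

/-- The section of a closed tropical cone by the plane of two coordinates, one axis of which is
inside the cone and the other outside, is cut out by one inequality. -/
lemma exists_pairVec_mem_iff (hV : TropCone V) (hc : IsClosed V) {i j : Fin n}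
    (hi : Pi.single i (1 : ℝ≥0) ∈ V) (hj : Pi.single j (1 : ℝ≥0) ∉ V) :
    ∃ t : ℝ≥0, ∀ a b, pairVec i a j b ∈ V ↔ b ≤ t * a := by
  have up : ∀ {a a' b}, a ≤ a' → pairVec i a j b ∈ V → pairVec i a' j b ∈ V := by
    intro a a' b h hm
    have := hV.sup_mem_s16 (hV.single_mem hi a') hm
    rwa [pairVec, ← sup_assoc,
      sup_eq_left.2 (single_le_of_le_apply (x := Pi.single i a') (by simpa using h))] at this
  have down : ∀ {a b b'}, b' ≤ b → pairVec i a j b ∈ V → pairVec i a j b' ∈ V := by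
    intro a b b' h hm
    rcases eq_or_ne b 0 with rfl | hb
    · rwa [nonpos_iff_eq_zero.1 h]
    have := hV.smul_mem (b' / b) hm
    rw [smul_pairVec, div_mul_cancel₀ _ hb] at this
    refine up ?_ this
    exact mul_le_of_le_one_left zero_le (div_le_one_of_le₀ h zero_le)
  have hzero : ∀ {b}, b ≠ 0 → pairVec i 0 j b ∉ V := by
    intro b hb hm
    have := hV.smul_mem b⁻¹ hm
    rw [smul_pairVec, inv_mul_cancel₀ hb, mul_zero] at this
    exact hj (by simpa [pairVec] using this)
  set S : Set ℝ≥0 := {b | pairVec i 1 j b ∈ V} with hS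
  have hSc : IsClosed S :=
    hc.preimage
      ((continuous_pairVec i j).comp (by fun_prop : Continuous fun b : ℝ≥0 => ((1 : ℝ≥0), b)))
  have hT : IsOpen {a : ℝ≥0 | pairVec i a j 1 ∉ V} :=
    hc.isOpen_compl.preimage
      ((continuous_pairVec i j).comp (by fun_prop : Continuous fun a : ℝ≥0 => (a, (1 : ℝ≥0))))
  have hS0 : (0 : ℝ≥0) ∈ S := by simpa [hS, pairVec] using hi
  obtain ⟨ε, hε, hεT⟩ : ∃ ε : ℝ≥0, 0 < ε ∧ pairVec i ε j 1 ∉ V := by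
    have h1 := hT.mem_nhds (hzero one_ne_zero)
    obtain ⟨u, hu, hsub⟩ := exists_Ico_subset_of_mem_nhds h1 ⟨1, one_pos⟩
    obtain ⟨a, ha, hau⟩ := exists_between hu
    exact ⟨a, ha, hsub ⟨ha.le, hau⟩⟩
  have hSb : BddAbove S := by
    refine ⟨ε⁻¹, fun b hb => ?_⟩
    by_contra! hlt
    have := hV.smul_mem ε (down hlt.le hb)
    rw [smul_pairVec, mul_inv_cancel₀ hε.ne', mul_one] at this
    exact hεT this
  have hmem : ∀ b, pairVec i 1 j b ∈ V ↔ b ≤ sSup S := fun b =>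
    ⟨fun h => le_csSup hSb h, fun h => down h (hSc.csSup_mem ⟨0, hS0⟩ hSb)⟩
  refine ⟨sSup S, fun a b => ?_⟩
  rcases eq_or_ne a 0 with rfl | ha
  · rw [mul_zero, nonpos_iff_eq_zero]
    refine ⟨fun h => by_contra fun hb => hzero hb h, ?_⟩
    rintro rfl
    simpa [pairVec] using hV.zero_mem_s16
  · rw [← div_le_iff₀ (pos_iff_ne_zero.2 ha), ← hmem]
    constructor <;> intro h
    · simpa [smul_pairVec, ha, div_eq_inv_mul] using hV.smul_mem a⁻¹ h
    · simpa [smul_pairVec, ha, mul_div_cancel₀] using hV.smul_mem a h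

/-- Two positive factors strictly above given bounds can be chosen with a prescribed product, as
long as that product exceeds the product of the bounds. -/
lemma exists_lt_lt_mul_eq {p q r : ℝ≥0} (h : p * q < r) : ∃ a b, p < a ∧ q < b ∧ a * b = r := by
  have hr : 0 < r := lt_of_le_of_lt zero_le h
  rcases eq_or_ne q 0 with rfl | hq
  · have : 0 < p + 1 := by positivity
    exact ⟨p + 1, r / (p + 1), lt_add_one p, by positivity, mul_div_cancel₀ _ this.ne'⟩
  · have hq' : 0 < q := pos_iff_ne_zero.2 hq
    obtain ⟨a, ha, har⟩ := exists_between ((lt_div_iff₀ hq').2 h)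
    have ha0 : 0 < a := lt_of_le_of_lt zero_le ha
    refine ⟨a, r / a, ha, ?_, mul_div_cancel₀ _ ha0.ne'⟩
    rw [lt_div_iff₀ ha0, mul_comm]
    exact (lt_div_iff₀ hq').1 har

/-- The `2 × 2` minors of the matrix of thresholds of a conical hemispace vanish. -/
lemma threshold_mul_le {W : Set (Fin n → ℝ≥0)} (hV : TropCone V) (hW : TropCone W)
    (hVW : ∀ x, x ≠ 0 → (x ∈ W ↔ x ∉ V)) {t : Fin n → Fin n → ℝ≥0} {i i' j j' : Fin n}
    (hij : ∀ a b, pairVec i a j b ∈ V ↔ b ≤ t i j * a)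
    (hij' : ∀ a b, pairVec i a j' b ∈ V ↔ b ≤ t i j' * a)
    (hi'j : ∀ a b, pairVec i' a j b ∈ V ↔ b ≤ t i' j * a)
    (hi'j' : ∀ a b, pairVec i' a j' b ∈ V ↔ b ≤ t i' j' * a) :
    t i j * t i' j' ≤ t i j' * t i' j := by
  by_contra! hlt
  obtain ⟨l, m, hl, hm, hlm⟩ := exists_lt_lt_mul_eq hlt
  have hl0 : l ≠ 0 := (lt_of_le_of_lt zero_le hl).ne'
  have hm0 : m ≠ 0 := (lt_of_le_of_lt zero_le hm).ne'
  set c := t i j / m with hc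
  have hcm : m * c = t i j := mul_div_cancel₀ _ hm0
  have hcl : t i' j' * c = l := by
    rw [hc, mul_div_assoc', mul_comm, ← hlm, mul_div_cancel_right₀ _ hm0]
  have hc0 : 0 < c := by
    rw [pos_iff_ne_zero]
    intro h
    rw [h, mul_zero] at hcl
    exact hl0 hcl.symm
  have h1 : pairVec i 1 j (t i j) ⊔ pairVec i' c j' l ∈ V :=
    hV.sup_mem_s16 ((hij _ _).2 (by simp)) ((hi'j' _ _).2 hcl.ge)
  have h2 : pairVec i 1 j' l ⊔ pairVec i' c j (t i j) ∈ W := by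
    refine hW.sup_mem_s16 ((hVW _ (pairVec_ne_zero_left one_ne_zero)).2 ?_)
      ((hVW _ (pairVec_ne_zero_left hc0.ne')).2 ?_)
    · rw [hij']; simpa using hl
    · rw [hi'j, ← hcm]; simpa [hc0] using hm
  have heq : pairVec i 1 j' l ⊔ pairVec i' c j (t i j) =
      pairVec i 1 j (t i j) ⊔ pairVec i' c j' l := by
    simp only [pairVec]
    ac_rfl
  rw [heq, hVW] at h2
  · exact h2 h1
  · intro h0
    exact pairVec_ne_zero_left one_ne_zero (le_bot_iff.1 ((le_sup_left).trans_eq h0))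

/-- A nonnegative matrix with vanishing `2 × 2` minors on a block factors on it. -/
lemma exists_mul_of_minors {A B : Fin n → Prop} {t : Fin n → Fin n → ℝ≥0}
    (h : ∀ i, A i → ∀ i', A i' → ∀ j, B j → ∀ j', B j' →
      t i j * t i' j' = t i j' * t i' j) :
    ∃ β δ : Fin n → ℝ≥0, ∀ i, A i → ∀ j, B j → t i j = β i * δ j := by
  by_cases h0 : ∃ a, A a ∧ ∃ b, B b ∧ t a b ≠ 0
  · obtain ⟨a, ha, b, hb, hab⟩ := h0
    refine ⟨fun i => t i b, fun j => t a j / t a b, fun i hi j hj => ?_⟩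
    rw [mul_div_assoc', eq_div_iff hab]
    exact h i hi a ha j hj b hb
  · push Not at h0
    exact ⟨0, 0, fun i hi j hj => by simp [h0 i hi j hj]⟩

/-- A conical hemispace with thresholds is cut out by the thresholds of its planar sections. -/
lemma mem_iff_of_thresholds {W : Set (Fin n → ℝ≥0)} (hV : TropCone V) (hW : TropCone W)
    (hVW : ∀ x, x ≠ 0 → (x ∈ W ↔ x ∉ V)) {t : Fin n → Fin n → ℝ≥0}
    (ht : ∀ i j, Pi.single i (1 : ℝ≥0) ∈ V → Pi.single j (1 : ℝ≥0) ∉ V →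
      ∀ a b, pairVec i a j b ∈ V ↔ b ≤ t i j * a) (x : Fin n → ℝ≥0) :
    x ∈ V ↔ ∀ j, Pi.single j (1 : ℝ≥0) ∉ V → x j ≠ 0 →
      ∃ i, Pi.single i (1 : ℝ≥0) ∈ V ∧ x j ≤ t i j * x i := by
  constructor
  · intro hx j hj hxj
    by_contra! hlt
    have hx0 : x ≠ 0 := fun h => hxj (congrFun h j)
    refine (hVW x hx0).1 (hW.mem_of_forall_exists_le fun k => ?_) hx
    by_cases hk : Pi.single k (1 : ℝ≥0) ∈ V
    · refine ⟨_, (hVW _ (pairVec_ne_zero_right hxj)).2 ?_, pairVec_apply_le k j x,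
        pairVec_apply_left k j x⟩
      rw [ht k j hk hj]
      exact (hlt k hk).not_ge
    · refine ⟨Pi.single k (x k), hW.single_mem ((hVW _ (by simp)).2 hk) _,
        single_le_of_le_apply le_rfl, by simp⟩
  · intro h
    refine hV.mem_of_forall_exists_le fun k => ?_
    by_cases hk : Pi.single k (1 : ℝ≥0) ∈ V
    · exact ⟨Pi.single k (x k), hV.single_mem hk _, single_le_of_le_apply le_rfl, by simp⟩
    by_cases hxk : x k = 0
    · exact ⟨0, hV.zero_mem_s16, fun _ => zero_le, by simp [hxk]⟩
    · obtain ⟨i, hi, hik⟩ := h k hk hxk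
      exact ⟨_, (ht i k hi hk _ _).2 hik, pairVec_apply_le i k x, pairVec_apply_right i k x⟩

/-- A closed conical hemispace is a tropical half-space. -/
lemma IsConicalHemispace.exists_halfspace (hV : IsConicalHemispace V) (hc : IsClosed V) :
    ∃ I J L : Finset (Fin n), Disjoint I J ∧ Disjoint I L ∧ Disjoint J L ∧
      ∃ β γ : Fin n → ℝ≥0, (∀ i ∈ I, 0 < β i) ∧ (∀ j ∈ J, 0 < γ j) ∧
        V = {x | (J.sup fun j => γ j * x j) ≤ (I.sup fun i => β i * x i) ∧
              ∀ i ∈ L, x i = 0} := by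
  classical
  obtain ⟨hV, W, hW, hint, huni⟩ := hV
  have hVW : ∀ x, x ≠ 0 → (x ∈ W ↔ x ∉ V) := by
    intro x hx
    refine ⟨fun h h' => hx (hint.subset ⟨h', h⟩), fun h => ?_⟩
    exact (huni.superset (Set.mem_univ x)).resolve_left h
  have hex : ∀ i j, ∃ t : ℝ≥0, Pi.single i (1 : ℝ≥0) ∈ V → Pi.single j (1 : ℝ≥0) ∉ V →
      ∀ a b, pairVec i a j b ∈ V ↔ b ≤ t * a := by
    intro i j
    by_cases hi : Pi.single i (1 : ℝ≥0) ∈ V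
    · by_cases hj : Pi.single j (1 : ℝ≥0) ∈ V
      · exact ⟨0, fun _ h => (h hj).elim⟩
      · obtain ⟨t, ht⟩ := exists_pairVec_mem_iff hV hc hi hj
        exact ⟨t, fun _ _ => ht⟩
    · exact ⟨0, fun h => (hi h).elim⟩
  choose t ht using hex
  obtain ⟨β, δ, hβδ⟩ := exists_mul_of_minors (t := t) (A := fun i => Pi.single i (1 : ℝ≥0) ∈ V)
    (B := fun j => Pi.single j (1 : ℝ≥0) ∉ V) fun i hi i' hi' j hj j' hj' => le_antisymm
      (threshold_mul_le hV hW hVW (ht i j hi hj) (ht i j' hi hj') (ht i' j hi' hj)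
        (ht i' j' hi' hj'))
      (threshold_mul_le hV hW hVW (ht i j' hi hj') (ht i j hi hj) (ht i' j' hi' hj')
        (ht i' j hi' hj))
  have hmem := mem_iff_of_thresholds hV hW hVW ht
  refine ⟨Finset.univ.filter fun i => Pi.single i (1 : ℝ≥0) ∈ V ∧ β i ≠ 0,
    Finset.univ.filter fun j => Pi.single j (1 : ℝ≥0) ∉ V ∧ δ j ≠ 0,
    Finset.univ.filter fun j => Pi.single j (1 : ℝ≥0) ∉ V ∧ δ j = 0,
    ?_, ?_, ?_, β, fun j => (δ j)⁻¹, ?_, ?_, ?_⟩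
  · rw [Finset.disjoint_left]; simp only [Finset.mem_filter]; tauto
  · rw [Finset.disjoint_left]; simp only [Finset.mem_filter]; tauto
  · rw [Finset.disjoint_left]; simp only [Finset.mem_filter]; tauto
  · simp [pos_iff_ne_zero]
  · simp [pos_iff_ne_zero]
  ext x
  rw [hmem]
  simp only [Set.mem_ofPred_eq, Finset.sup_le_iff, Finset.mem_filter, Finset.mem_univ, true_and]
  constructor
  · intro h
    refine ⟨fun j ⟨hj, hδ⟩ => ?_, fun j ⟨hj, hδ⟩ => ?_⟩
    · by_cases hxj : x j = 0
      · simp [hxj]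
      obtain ⟨i, hi, hij⟩ := h j hj hxj
      rw [hβδ i hi j hj] at hij
      have hβ : β i ≠ 0 := by
        rintro h0
        simp [h0, hxj] at hij
      refine le_trans ?_ (Finset.le_sup (f := fun i => β i * x i) (b := i) (by simp [hi, hβ]))
      rw [inv_mul_le_iff₀ (pos_iff_ne_zero.2 hδ)]
      exact hij.trans_eq (by ring)
    · by_contra hxj
      obtain ⟨i, hi, hij⟩ := h j hj hxj
      rw [hβδ i hi j hj, hδ] at hij
      simp [hxj] at hij
  · rintro ⟨h1, h2⟩ j hj hxj
    have hδ : δ j ≠ 0 := fun h0 => hxj (h2 j ⟨hj, h0⟩)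
    have hle := h1 j ⟨hj, hδ⟩
    have hpos : ⊥ < (δ j)⁻¹ * x j := by
      rw [bot_eq_zero]
      exact mul_pos (inv_pos.2 (pos_iff_ne_zero.2 hδ)) (pos_iff_ne_zero.2 hxj)
    obtain ⟨i, hi, hij⟩ := (Finset.le_sup_iff hpos).1 hle
    have hiV := (Finset.mem_filter.1 hi).2.1
    refine ⟨i, hiV, ?_⟩
    rw [inv_mul_le_iff₀ (pos_iff_ne_zero.2 hδ)] at hij
    rw [hβδ i hiV j hj]
    exact hij.trans_eq (by ring)

lemma finset_sup_mul_max (s : Finset (Fin n)) (β x y : Fin n → ℝ≥0) :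
    (s.sup fun i => β i * max (x i) (y i)) =
      max (s.sup fun i => β i * x i) (s.sup fun i => β i * y i) := by
  simp only [mul_max]
  exact Finset.sup_sup

lemma finset_sup_mul_smul (s : Finset (Fin n)) (β x : Fin n → ℝ≥0) (c : ℝ≥0) :
    (s.sup fun i => β i * (c * x i)) = c * s.sup fun i => β i * x i := by
  rw [NNReal.mul_finset_sup]
  exact Finset.sup_congr rfl fun i _ => mul_left_comm _ _ _

lemma continuous_finset_sup_mul (s : Finset (Fin n)) (β : Fin n → ℝ≥0) :
    Continuous fun x : Fin n → ℝ≥0 => s.sup fun i => β i * x i :=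
  Continuous.finset_sup_apply fun i _ => by fun_prop

lemma isClosed_halfspace (I J L : Finset (Fin n)) (β γ : Fin n → ℝ≥0) :
    IsClosed {x : Fin n → ℝ≥0 | (J.sup fun j => γ j * x j) ≤ (I.sup fun i => β i * x i) ∧
      ∀ i ∈ L, x i = 0} := by
  simp only [Set.ofPred_and, Set.ofPred_forall]
  exact (isClosed_le (continuous_finset_sup_mul J γ) (continuous_finset_sup_mul I β)).inter
    (isClosed_biInter fun i _ => isClosed_eq (continuous_apply i) continuous_const)

lemma isConicalHemispace_halfspace (I J L : Finset (Fin n)) (β γ : Fin n → ℝ≥0) :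
    IsConicalHemispace {x : Fin n → ℝ≥0 |
      (J.sup fun j => γ j * x j) ≤ (I.sup fun i => β i * x i) ∧ ∀ i ∈ L, x i = 0} := by
  set V := {x : Fin n → ℝ≥0 |
    (J.sup fun j => γ j * x j) ≤ (I.sup fun i => β i * x i) ∧ ∀ i ∈ L, x i = 0} with hV
  have h0 : (0 : Fin n → ℝ≥0) ∈ V := by simp [hV]
  have hsmul : ∀ x ∈ V, ∀ c : ℝ≥0, (fun i => c * x i) ∈ V := by
    rintro x ⟨hx, hxL⟩ c
    refine ⟨?_, fun i hi => by simp [hxL i hi]⟩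
    rw [finset_sup_mul_smul, finset_sup_mul_smul]
    gcongr
  have hcompl : ∀ x, x ∉ V ↔ (I.sup fun i => β i * x i) < (J.sup fun j => γ j * x j) ∨
      ∃ i ∈ L, 0 < x i := by
    intro x
    simp only [hV, Set.mem_ofPred_eq, not_and_or, not_le, not_forall, pos_iff_ne_zero, exists_prop]
  refine ⟨⟨⟨0, h0⟩, ?_, hsmul⟩, Vᶜ ∪ {0}, ⟨⟨0, by simp⟩, ?_, ?_⟩, ?_, ?_⟩
  · rintro x ⟨hx, hxL⟩ y ⟨hy, hyL⟩
    refine ⟨?_, fun i hi => by simp [hxL i hi, hyL i hi]⟩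
    rw [finset_sup_mul_max, finset_sup_mul_max]
    exact max_le_max hx hy
  · rintro x (hx | rfl) y (hy | rfl)
    · refine Or.inl ?_
      rw [Set.mem_compl_iff, hcompl] at hx hy ⊢
      rw [finset_sup_mul_max, finset_sup_mul_max]
      rcases hx with hx | ⟨i, hi, hx⟩
      · rcases hy with hy | ⟨i, hi, hy⟩
        · exact Or.inl (max_lt_max hx hy)
        · exact Or.inr ⟨i, hi, lt_max_of_lt_right hy⟩
      · exact Or.inr ⟨i, hi, lt_max_of_lt_left hx⟩
    · left; simpa using hx
    · left; simpa using hy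
    · right; funext i; simp
  · rintro x (hx | rfl) c
    · rcases eq_or_ne c 0 with rfl | hc
      · right; funext i; simp
      · refine Or.inl fun h => hx ?_
        simpa [hc] using hsmul _ h c⁻¹
    · right; funext i; simp
  · ext x
    simp only [Set.mem_inter_iff, Set.mem_union, Set.mem_compl_iff, Set.mem_singleton_iff]
    constructor
    · tauto
    · rintro rfl
      exact ⟨h0, Or.inr rfl⟩
  · rw [← Set.union_assoc, Set.union_compl_self, Set.univ_union]

end Hemispace

theorem stmt16 {n : ℕ} (V : Set (Fin n → ℝ≥0)) :
    (IsClosed V ∧ IsConicalHemispace V) ↔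
      ∃ I J L : Finset (Fin n), Disjoint I J ∧ Disjoint I L ∧ Disjoint J L ∧
        ∃ β γ : Fin n → ℝ≥0, (∀ i ∈ I, 0 < β i) ∧ (∀ j ∈ J, 0 < γ j) ∧
          V = {x | (J.sup fun j => γ j * x j) ≤ (I.sup fun i => β i * x i) ∧
                ∀ i ∈ L, x i = 0} := by
  constructor
  · rintro ⟨hc, hV⟩
    exact hV.exists_halfspace hc
  · rintro ⟨I, J, L, -, -, -, β, γ, -, -, rfl⟩
    exact ⟨isClosed_halfspace I J L β γ, isConicalHemispace_halfspace I J L β γ⟩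
end

section
/- If H ⊆ ℝ≥0^n is a hemispace, then its topological closure cl(H) is a hemispace; that is, cl(H) is tropically convex and ℝ≥0^n \ cl(H) is tropically convex. -/
open scoped NNReal

/-- The closure of a tropically convex set is tropically convex. -/
theorem TropConvex.closure {n : ℕ} {C : Set (Fin n → ℝ≥0)} (hC : TropConvex C) :
    TropConvex (closure C) := by
  intro x hx y hy α β hαβ
  exact map_mem_closure₂
    (f := fun (x y : Fin n → ℝ≥0) i => max (α * x i) (β * y i)) (by fun_prop) hx hy
    fun a ha b hb => hC a ha b hb α β hαβ

/-- The interior of a tropically convex set is tropically convex. -/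
theorem TropConvex.interior {n : ℕ} {C : Set (Fin n → ℝ≥0)} (hC : TropConvex C) :
    TropConvex (interior C) := by
  intro x hx y hy α β hαβ
  rcases eq_or_ne α 0 with rfl | hα
  · obtain rfl : β = 1 := by simpa using hαβ
    simpa using hy
  rcases eq_or_ne β 0 with rfl | hβ
  · obtain rfl : α = 1 := by simpa using hαβ
    simpa using hx
  rw [mem_interior_iff_mem_nhds] at hx hy ⊢
  set z : Fin n → ℝ≥0 := fun i => max (α * x i) (β * y i) with hz
  let f : (Fin n → ℝ≥0) → Fin n → ℝ≥0 := fun w i =>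
    if β * y i ≤ α * x i then α⁻¹ * w i else x i
  let g : (Fin n → ℝ≥0) → Fin n → ℝ≥0 := fun w i =>
    if α * x i ≤ β * y i then β⁻¹ * w i else y i
  have hf : Continuous f := by
    refine continuous_pi fun i => ?_
    by_cases h : β * y i ≤ α * x i <;> simp only [f, h, if_true, if_false] <;> fun_prop
  have hg : Continuous g := by
    refine continuous_pi fun i => ?_
    by_cases h : α * x i ≤ β * y i <;> simp only [g, h, if_true, if_false] <;> fun_prop
  have hfz : f z = x := by
    ext1 i
    by_cases h : β * y i ≤ α * x i <;> simp [f, hz, h, hα]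
  have hgz : g z = y := by
    ext1 i
    by_cases h : α * x i ≤ β * y i <;> simp [g, hz, h, hβ]
  have hmax : ∀ᶠ w in nhds z, ∀ i, max (α * f w i) (β * g w i) = w i := by
    refine Filter.eventually_all.2 fun i => ?_
    have hi : Filter.Tendsto (fun w : Fin n → ℝ≥0 => w i) (nhds z) (nhds (z i)) :=
      (continuous_apply i).tendsto z
    rcases lt_trichotomy (α * x i) (β * y i) with h | h | h
    · filter_upwards [hi.eventually_const_lt (show α * x i < z i from lt_max_of_lt_right h)]
        with w hw
      simp [f, g, h.le, h.not_ge, hβ, hw.le]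
    · filter_upwards with w
      simp [f, g, h, hα, hβ]
    · filter_upwards [hi.eventually_const_lt (show β * y i < z i from lt_max_of_lt_left h)]
        with w hw
      simp [f, g, h.le, h.not_ge, hα, hw.le]
  filter_upwards [hmax, hf.continuousAt.eventually_mem (hfz.symm ▸ hx),
    hg.continuousAt.eventually_mem (hgz.symm ▸ hy)] with w hw hfw hgw
  exact funext hw ▸ hC _ hfw _ hgw α β hαβ

theorem stmt17 {n : ℕ} (H : Set (Fin n → ℝ≥0))
    (h1 : TropConvex H) (h2 : TropConvex Hᶜ) :
    TropConvex (closure H) ∧ TropConvex (closure H)ᶜ := by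
  refine ⟨h1.closure, ?_⟩
  rw [← interior_compl]
  exact h2.interior
end

section
/- A set H ⊆ ℝ≥0^n is simultaneously closed (in the product topology) and a hemispace if and only if there exist pairwise disjoint subsets I, J, L of {1,…,n}, scalars α, δ ∈ ℝ≥0, and coefficients β_i ∈ (0,∞) for i ∈ I and γ_j ∈ (0,∞) for j ∈ J, such that H = {x ∈ ℝ≥0^n : max(max_{j∈J} γ_j·x_j, α) ≤ max(max_{i∈I} β_i·x_i, δ) and x_j = 0 for all j ∈ L}, where a maximum over the empty index set is 0. -/
open scoped NNReal

/-- A subset of `ℝ≥0^ι` that is a tropical cone and whose complement is closed under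
coordinatewise maxima. -/
structure IsConicHemispace {ι : Type*} (W : Set (ι → ℝ≥0)) : Prop where
  zero_mem : 0 ∈ W
  sup_mem : ∀ x ∈ W, ∀ y ∈ W, x ⊔ y ∈ W
  smul_mem : ∀ x ∈ W, ∀ s : ℝ≥0, s • x ∈ W
  sup_notMem : ∀ x ∉ W, ∀ y ∉ W, x ⊔ y ∉ W

namespace IsConicHemispace

variable {ι : Type*} {W : Set (ι → ℝ≥0)}

lemma smul_mem_iff (hW : IsConicHemispace W) {s : ℝ≥0} (hs : s ≠ 0) {x : ι → ℝ≥0} :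
    s • x ∈ W ↔ x ∈ W := by
  refine ⟨fun h => ?_, fun h => hW.smul_mem x h s⟩
  simpa [smul_smul, hs] using hW.smul_mem _ h s⁻¹

lemma finset_sup_mem (hW : IsConicHemispace W) {κ : Type*} (S : Finset κ)
    (f : κ → ι → ℝ≥0) (hf : ∀ k ∈ S, f k ∈ W) : S.sup f ∈ W :=
  Finset.sup_induction hW.zero_mem (fun x hx y hy => hW.sup_mem x hx y hy) hf

lemma notMem_sup_finset_sup (hW : IsConicHemispace W) {κ : Type*} {x : ι → ℝ≥0} (hx : x ∉ W)
    (S : Finset κ) (f : κ → ι → ℝ≥0) (hf : ∀ k ∈ S, x ⊔ f k ∉ W) : x ⊔ S.sup f ∉ W := by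
  classical
  induction S using Finset.induction_on with
  | empty => simpa using hx
  | insert a S ha ih =>
    have h := hW.sup_notMem _ (hf a (Finset.mem_insert_self a S)) _
      (ih fun k hk => hf k (Finset.mem_insert_of_mem hk))
    rwa [Finset.sup_insert, sup_sup_distrib_left]

variable [DecidableEq ι]

lemma single_mem_iff (hW : IsConicHemispace W) {i : ι} {a : ℝ≥0} (ha : a ≠ 0) :
    Pi.single i a ∈ W ↔ Pi.single i (1 : ℝ≥0) ∈ W := by
  rw [← hW.smul_mem_iff ha (x := Pi.single i 1), ← Pi.single_smul]
  simp

lemma smul_single_sup_single (s a b : ℝ≥0) (i j : ι) :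
    s • (Pi.single i a ⊔ Pi.single j b : ι → ℝ≥0) = Pi.single i (s * a) ⊔ Pi.single j (s * b) := by
  ext k
  have h1 : (Pi.single i (s * a) : ι → ℝ≥0) k = s * (Pi.single i a : ι → ℝ≥0) k := by
    simp [Pi.single_apply]
  have h2 : (Pi.single j (s * b) : ι → ℝ≥0) k = s * (Pi.single j b : ι → ℝ≥0) k := by
    simp [Pi.single_apply]
  simp [h1, h2, mul_max]

lemma exists_mem_plane_iff (hW : IsConicHemispace W) (hc : IsClosed W) {i j : ι}
    (hi : Pi.single i (1 : ℝ≥0) ∈ W) (hj : Pi.single j (1 : ℝ≥0) ∉ W) :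
    ∃ t : ℝ≥0, ∀ a b : ℝ≥0,
      (Pi.single i a ⊔ Pi.single j b : ι → ℝ≥0) ∈ W ↔ b ≤ t * a := by
  set T : Set ℝ≥0 := {s | (Pi.single i 1 ⊔ Pi.single j s : ι → ℝ≥0) ∈ W} with hT
  have hcont : ∀ k : ι, Continuous fun s : ℝ≥0 => (Pi.single k s : ι → ℝ≥0) := fun k =>
    continuous_single (A := fun _ => ℝ≥0) k
  have hsup : ∀ f g : ℝ≥0 → ι → ℝ≥0, Continuous f → Continuous g → Continuous fun s => f s ⊔ g s :=
    fun f g hf hg => continuous_pi fun k =>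
      ((continuous_apply k).comp hf).sup ((continuous_apply k).comp hg)
  have hTc : IsClosed T := hc.preimage (hsup _ _ continuous_const (hcont j))
  have hT0 : 0 ∈ T := by
    simp only [hT, Set.mem_ofPred_eq, Pi.single_zero]
    exact hW.sup_mem _ hi _ hW.zero_mem
  have hdown : ∀ s ∈ T, ∀ s' ≤ s, s' ∈ T := by
    intro s hs s' hle
    rcases eq_or_ne s 0 with rfl | h0
    · rwa [nonpos_iff_eq_zero.1 hle]
    · have h := hW.sup_mem _ hi _ (hW.smul_mem _ hs (s' / s))
      rw [smul_single_sup_single, ← sup_assoc, mul_one, div_mul_cancel₀ _ h0] at h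
      have h1 : s' / s ≤ 1 := div_le_one_of_le₀ hle (by positivity)
      rwa [sup_eq_left.2 (Pi.single_mono i h1 :
        (Pi.single i (s' / s) : ι → ℝ≥0) ≤ Pi.single i 1)] at h
  have hbdd : BddAbove T := by
    by_contra hb
    rw [not_bddAbove_iff] at hb
    have hall : ∀ s, s ∈ T := fun s => by
      obtain ⟨s', hs', hlt⟩ := hb s
      exact hdown s' hs' s hlt.le
    set U : Set ℝ≥0 := {u | (Pi.single i u ⊔ Pi.single j 1 : ι → ℝ≥0) ∈ W} with hU
    have hUc : IsClosed U := hc.preimage (hsup _ _ (hcont i) continuous_const)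
    have hpos : Set.Ioi (0 : ℝ≥0) ⊆ U := by
      intro u hu
      have h := hW.smul_mem _ (hall u⁻¹) u
      rw [smul_single_sup_single, mul_one, mul_inv_cancel₀ (ne_of_gt hu)] at h
      exact h
    have h0 : (0 : ℝ≥0) ∈ U := by
      apply hUc.closure_subset_iff.2 hpos
      rw [closure_Ioi]
      exact Set.self_mem_Ici
    apply hj
    have h0' : (Pi.single i 0 ⊔ Pi.single j 1 : ι → ℝ≥0) ∈ W := h0
    rwa [Pi.single_zero, sup_eq_right.2 zero_le] at h0'
  refine ⟨sSup T, fun a b => ?_⟩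
  have hmem : ∀ s, s ∈ T ↔ s ≤ sSup T := fun s =>
    ⟨fun h => le_csSup hbdd h, hdown _ (hTc.csSup_mem ⟨0, hT0⟩ hbdd) s⟩
  rcases eq_or_ne a 0 with rfl | ha
  · rw [Pi.single_zero, sup_eq_right.2 zero_le, mul_zero, nonpos_iff_eq_zero]
    refine ⟨fun h => ?_, fun h => by simpa [h] using hW.zero_mem⟩
    by_contra hb
    exact hj ((hW.single_mem_iff hb).1 h)
  · have h := hmem (b / a)
    rw [div_le_iff₀ (pos_iff_ne_zero.2 ha)] at h
    rw [← h, hT, Set.mem_ofPred_eq,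
      ← hW.smul_mem_iff ha (x := Pi.single i 1 ⊔ Pi.single j (b / a)), smul_single_sup_single,
      mul_one, mul_div_cancel₀ _ ha]

lemma mul_le_mul_swap (hW : IsConicHemispace W) {i k j l : ι} {tij til tkj tkl : ℝ≥0}
    (hij : ∀ a b : ℝ≥0, (Pi.single i a ⊔ Pi.single j b : ι → ℝ≥0) ∈ W ↔ b ≤ tij * a)
    (hil : ∀ a b : ℝ≥0, (Pi.single i a ⊔ Pi.single l b : ι → ℝ≥0) ∈ W ↔ b ≤ til * a)
    (hkj : ∀ a b : ℝ≥0, (Pi.single k a ⊔ Pi.single j b : ι → ℝ≥0) ∈ W ↔ b ≤ tkj * a)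
    (hkl : ∀ a b : ℝ≥0, (Pi.single k a ⊔ Pi.single l b : ι → ℝ≥0) ∈ W ↔ b ≤ tkl * a) :
    tij * tkl ≤ til * tkj := by
  by_contra! hlt
  have hpos : 0 < tkl := by
    rcases eq_or_ne tkl 0 with h | h
    · simp [h] at hlt
    · exact pos_iff_ne_zero.2 h
  obtain ⟨r, hr, hr'⟩ : ∃ r, til / tkl < r ∧ r * tkj < tij := by
    have hcont : Continuous fun r : ℝ≥0 => r * tkj := continuous_id.mul continuous_const
    have hlt' : til / tkl * tkj < tij := by
      rw [div_mul_eq_mul_div, div_lt_iff₀ hpos]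
      exact hlt
    have hev := (hcont.tendsto (til / tkl)).eventually_lt_const hlt'
    have hev' := hev.filter_mono (nhdsWithin_le_nhds (s := Set.Ioi (til / tkl)))
    obtain ⟨r, h1, h2⟩ := (hev'.and self_mem_nhdsWithin).exists
    exact ⟨r, h2, h1⟩
  rw [div_lt_iff₀ hpos] at hr
  have h1 := hW.sup_mem _ ((hij 1 tij).2 (by simp)) _ ((hkl r (tkl * r)).2 le_rfl)
  have h2 : (Pi.single i 1 ⊔ Pi.single l (tkl * r) : ι → ℝ≥0) ∉ W := by
    rw [hil, mul_one, not_le, mul_comm]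
    exact hr
  have h3 : (Pi.single k r ⊔ Pi.single j tij : ι → ℝ≥0) ∉ W := by
    rw [hkj, not_le, mul_comm]
    exact hr'
  apply hW.sup_notMem _ h2 _ h3
  convert h1 using 1
  ac_rfl

lemma mem_iff_of_plane [Fintype ι] (hW : IsConicHemispace W) (A : Finset ι)
    (hA : ∀ i, i ∈ A ↔ Pi.single i (1 : ℝ≥0) ∈ W) (t : ι → ι → ℝ≥0)
    (ht : ∀ i ∈ A, ∀ j ∉ A, ∀ a b : ℝ≥0,
      (Pi.single i a ⊔ Pi.single j b : ι → ℝ≥0) ∈ W ↔ b ≤ t i j * a) (x : ι → ℝ≥0) :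
    x ∈ W ↔ ∀ j ∉ A, x j ≤ A.sup fun i => t i j * x i := by
  have hsingle : ∀ (S : Finset ι) (k : ι),
      (S.sup fun m => (Pi.single m (x m) : ι → ℝ≥0)) k ≤ x k := by
    intro S k
    rw [Finset.sup_apply]
    refine Finset.sup_le fun m _ => ?_
    rcases eq_or_ne k m with rfl | h
    · simp
    · simp [h]
  constructor
  · intro hx j hj
    by_contra! hlt
    have hxj : x j ≠ 0 := (lt_of_le_of_lt zero_le hlt).ne'
    have hej : (Pi.single j (x j) : ι → ℝ≥0) ∉ W := by
      rw [hW.single_mem_iff hxj, ← hA]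
      exact hj
    refine hW.notMem_sup_finset_sup hej Finset.univ (fun m => Pi.single m (x m)) ?_ ?_
    · intro m _
      by_cases hm : m ∈ A
      · rw [sup_comm, ht m hm j hj, not_le]
        exact lt_of_le_of_lt (Finset.le_sup (f := fun i => t i j * x i) hm) hlt
      · rcases eq_or_ne (x m) 0 with h0 | h0
        · rw [h0, Pi.single_zero, sup_eq_left.2 zero_le]
          exact hej
        · refine hW.sup_notMem _ hej _ ?_
          rw [hW.single_mem_iff h0, ← hA]
          exact hm
    · convert hx using 1
      refine le_antisymm (sup_le ?_ (fun k => hsingle _ k)) ?_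
      · intro k
        rcases eq_or_ne k j with rfl | h
        · simp
        · simp [h]
      · refine le_sup_of_le_right fun k => ?_
        rw [Finset.sup_apply]
        exact le_trans (by simp) (Finset.le_sup (f := fun m => (Pi.single m (x m) : ι → ℝ≥0) k)
          (Finset.mem_univ k))
  · intro h
    have key : ∀ k, ∃ y ∈ W, y ≤ x ∧ y k = x k := by
      intro k
      rcases eq_or_ne (x k) 0 with h0 | h0
      · exact ⟨0, hW.zero_mem, zero_le, h0.symm⟩
      have hle : ∀ m, (Pi.single m (x m) : ι → ℝ≥0) ≤ x := fun m k =>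
        by simpa using hsingle {m} k
      by_cases hk : k ∈ A
      · exact ⟨Pi.single k (x k), (hW.single_mem_iff h0).2 ((hA k).1 hk), hle k, by simp⟩
      · have hA' : A.Nonempty := by
          by_contra hne
          rw [Finset.not_nonempty_iff_eq_empty] at hne
          have := h k hk
          simp [hne] at this
          exact h0 this
        obtain ⟨i, hi, hie⟩ := Finset.exists_mem_eq_sup A hA' fun i => t i k * x i
        refine ⟨Pi.single i (x i) ⊔ Pi.single k (x k), (ht i hi k hk _ _).2 ?_,
          sup_le (hle i) (hle k), ?_⟩
        · rw [← hie]
          exact h k hk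
        · exact le_antisymm (sup_le (hle i) (hle k) k) (by simp)
    choose y hy hyx hyk using key
    convert hW.finset_sup_mem Finset.univ y (fun k _ => hy k) using 1
    refine le_antisymm (fun k => ?_) (Finset.sup_le fun k _ => hyx k)
    rw [Finset.sup_apply, ← hyk k]
    exact Finset.le_sup (f := fun m => y m k) (Finset.mem_univ k)

theorem exists_halfspace [Fintype ι] (hW : IsConicHemispace W) (hc : IsClosed W) :
    ∃ I J L : Finset ι, Disjoint I J ∧ Disjoint I L ∧ Disjoint J L ∧
      ∃ β γ : ι → ℝ≥0, (∀ i ∈ I, 0 < β i) ∧ (∀ j ∈ J, 0 < γ j) ∧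
        ∀ x, x ∈ W ↔ (J.sup fun j => γ j * x j) ≤ (I.sup fun i => β i * x i) ∧
          ∀ j ∈ L, x j = 0 := by
  classical
  set A : Finset ι := Finset.univ.filter fun i => Pi.single i (1 : ℝ≥0) ∈ W with hAdef
  have hA : ∀ i, i ∈ A ↔ Pi.single i (1 : ℝ≥0) ∈ W := by simp [hAdef]
  have hex : ∀ i j, ∃ t : ℝ≥0, i ∈ A → j ∉ A → ∀ a b : ℝ≥0,
      (Pi.single i a ⊔ Pi.single j b : ι → ℝ≥0) ∈ W ↔ b ≤ t * a := by
    intro i j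
    by_cases h : i ∈ A ∧ j ∉ A
    · obtain ⟨t, ht⟩ := hW.exists_mem_plane_iff hc ((hA i).1 h.1) (mt (hA j).2 h.2)
      exact ⟨t, fun _ _ => ht⟩
    · exact ⟨0, fun h1 h2 => absurd ⟨h1, h2⟩ h⟩
  choose t ht using hex
  have hrank : ∀ i ∈ A, ∀ k ∈ A, ∀ j ∉ A, ∀ l ∉ A, t i j * t k l = t i l * t k j :=
    fun i hi k hk j hj l hl => le_antisymm
      (hW.mul_le_mul_swap (ht i j hi hj) (ht i l hi hl) (ht k j hk hj) (ht k l hk hl))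
      (hW.mul_le_mul_swap (ht i l hi hl) (ht i j hi hj) (ht k l hk hl) (ht k j hk hj))
  obtain ⟨b, c, hbc⟩ : ∃ b c : ι → ℝ≥0, ∀ i ∈ A, ∀ j ∉ A, t i j = b i * c j := by
    by_cases h : ∃ k ∈ A, ∃ l ∉ A, t k l ≠ 0
    · obtain ⟨k, hk, l, hl, h0⟩ := h
      refine ⟨fun i => t i l, fun j => t k j / t k l, fun i hi j hj => ?_⟩
      rw [← mul_div_assoc, eq_div_iff h0]
      exact hrank i hi k hk j hj l hl
    · push Not at h
      exact ⟨0, 0, fun i hi j hj => by simp [h i hi j hj]⟩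
  refine ⟨A.filter fun i => 0 < b i, Aᶜ.filter fun j => 0 < c j, Aᶜ.filter fun j => c j = 0,
    ?_, ?_, ?_, b, fun j => (c j)⁻¹, ?_, ?_, fun x => ?_⟩
  · rw [Finset.disjoint_left]
    simp +contextual
  · rw [Finset.disjoint_left]
    simp +contextual
  · rw [Finset.disjoint_left]
    simp +contextual [pos_iff_ne_zero]
  · simp
  · simp
  rw [hW.mem_iff_of_plane A hA t (fun i hi j hj => ht i j hi hj)]
  have hsup : ∀ j ∉ A, (A.sup fun i => t i j * x i) =
      c j * (A.filter fun i => 0 < b i).sup fun i => b i * x i := by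
    intro j hj
    rw [NNReal.mul_finset_sup]
    refine le_antisymm (Finset.sup_le fun i hi => ?_) (Finset.sup_le fun i hi => ?_)
    · rcases eq_or_ne (b i) 0 with h0 | h0
      · simp [hbc i hi j hj, h0]
      · refine le_trans (le_of_eq ?_) (Finset.le_sup (f := fun i => c j * (b i * x i))
          (Finset.mem_filter.2 ⟨hi, pos_iff_ne_zero.2 h0⟩))
        rw [hbc i hi j hj]
        ring
    · have hi' := (Finset.mem_filter.1 hi).1
      refine le_trans (le_of_eq ?_) (Finset.le_sup (f := fun i => t i j * x i) hi')
      simp only [hbc i hi' j hj]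
      ring
  constructor
  · intro h
    refine ⟨Finset.sup_le fun j hj => ?_, fun j hj => ?_⟩
    · obtain ⟨hjA, hcj⟩ := Finset.mem_filter.1 hj
      rw [Finset.mem_compl] at hjA
      rw [inv_mul_le_iff₀ hcj, ← hsup j hjA]
      exact h j hjA
    · obtain ⟨hjA, hcj⟩ := Finset.mem_filter.1 hj
      rw [Finset.mem_compl] at hjA
      simpa [hsup j hjA, hcj] using h j hjA
  · rintro ⟨h1, h2⟩ j hj
    rw [hsup j hj]
    rcases eq_or_ne (c j) 0 with h0 | h0
    · simp [h2 j (by simp [hj, h0])]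
    · have hcj := pos_iff_ne_zero.2 h0
      rw [← inv_mul_le_iff₀ hcj]
      exact le_trans (Finset.le_sup (f := fun j => (c j)⁻¹ * x j) (by simp [hj, hcj])) h1

end IsConicHemispace

/-- The closed cone over `H`; the coordinate `none` is the homogenizing one. -/
def homogenization {n : ℕ} (H : Set (Fin n → ℝ≥0)) : Set (Option (Fin n) → ℝ≥0) :=
  {w | ∀ h ∈ H, ∀ μ : ℝ≥0,
    (fun i => max (h i) (μ * w (some i)) / max 1 (μ * w none)) ∈ H}

lemma TropConvex.sup_smul_mem {n : ℕ} {C : Set (Fin n → ℝ≥0)} (hC : TropConvex C)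
    {x y : Fin n → ℝ≥0} (hx : x ∈ C) (hy : y ∈ C) {α β : ℝ≥0} (h : max α β = 1)
    {z : Fin n → ℝ≥0} (hz : ∀ i, z i = max (α * x i) (β * y i)) : z ∈ C := by
  rw [show z = fun i => max (α * x i) (β * y i) from funext hz]
  exact hC x hx y hy α β h

lemma isClosed_homogenization {n : ℕ} {H : Set (Fin n → ℝ≥0)} (hH : IsClosed H) :
    IsClosed (homogenization H) := by
  simp only [homogenization, Set.ofPred_forall]
  refine isClosed_iInter fun h => isClosed_iInter fun _ => isClosed_iInter fun μ => ?_
  refine hH.preimage (f := fun (w : Option (Fin n) → ℝ≥0) i =>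
    max (h i) (μ * w (some i)) / max 1 (μ * w none)) ?_
  refine continuous_pi fun i => Continuous.div₀ (by fun_prop) (by fun_prop) fun w => ?_
  exact (lt_of_lt_of_le one_pos (le_max_left _ _)).ne'

lemma isConicHemispace_homogenization {n : ℕ} {H : Set (Fin n → ℝ≥0)} (hH : TropConvex H)
    (hH' : TropConvex Hᶜ) : IsConicHemispace (homogenization H) where
  zero_mem := by
    intro h hh μ
    simpa using hh
  sup_mem := by
    intro x hx y hy h hh μ
    set p := max 1 (μ * x none) with hp
    set q := max 1 (μ * y none) with hq
    have hp0 : p ≠ 0 := (lt_of_lt_of_le one_pos (le_max_left _ _)).ne'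
    have hq0 : q ≠ 0 := (lt_of_lt_of_le one_pos (le_max_left _ _)).ne'
    have hpq : max p q ≠ 0 := (lt_max_of_lt_left (pos_iff_ne_zero.2 hp0)).ne'
    have hr : max 1 (μ * (x ⊔ y) none) = max p q := by
      rw [hp, hq, Pi.sup_apply, mul_max]
      exact sup_sup_distrib_left _ _ _
    refine hH.sup_smul_mem (hx h hh μ) (hy h hh μ) (α := p / max p q) (β := q / max p q) ?_ ?_
    · rw [max_div_div_right zero_le, div_self hpq]
    · intro i
      rw [hr, ← hp, ← hq, div_mul_div_comm, mul_comm p, mul_div_mul_right _ _ hp0,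
        div_mul_div_comm, mul_comm q, mul_div_mul_right _ _ hq0,
        max_div_div_right zero_le, Pi.sup_apply, mul_max]
      congr 1
      exact sup_sup_distrib_left _ _ _
  smul_mem := by
    intro x hx s h hh μ
    simpa [mul_assoc] using hx h hh (μ * s)
  sup_notMem := by
    intro x hx y hy hxy
    simp only [homogenization, Set.mem_ofPred_eq] at hx hy
    push Not at hx hy
    obtain ⟨h, hh, μ, hx⟩ := hx
    obtain ⟨k, hk, ν, hy⟩ := hy
    have hμ : 0 < μ := by
      rw [pos_iff_ne_zero]
      rintro rfl
      simp [hh] at hx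
    have hν : 0 < ν := by
      rw [pos_iff_ne_zero]
      rintro rfl
      simp [hk] at hy
    set m := max 1 (μ * x none) with hm
    set m' := max 1 (ν * y none) with hm'
    have hm0 : 0 < m := lt_of_lt_of_le one_pos (le_max_left _ _)
    have hm'0 : 0 < m' := lt_of_lt_of_le one_pos (le_max_left _ _)
    obtain ⟨p, q, hp, hpq, h1⟩ : ∃ p q : ℝ≥0, 0 < p ∧ p * μ = q * ν ∧ max (p * m) (q * m') = 1 := by
      have hd : 0 < max (ν * m) (μ * m') := lt_max_of_lt_left (mul_pos hν hm0)
      refine ⟨ν / max (ν * m) (μ * m'), μ / max (ν * m) (μ * m'), div_pos hν hd, by ring, ?_⟩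
      rw [div_mul_eq_mul_div, div_mul_eq_mul_div, max_div_div_right zero_le, div_self hd.ne']
    obtain ⟨c, hc⟩ : ∃ c, c = max p q := ⟨_, rfl⟩
    have hc0 : 0 < c := hc ▸ lt_max_of_lt_left hp
    have hden : max 1 (p * μ / c * (x ⊔ y) none) = c⁻¹ := by
      rw [← mul_eq_one_iff_eq_inv₀ hc0.ne', max_mul_of_nonneg _ _ zero_le, one_mul,
        mul_right_comm, div_mul_cancel₀ _ hc0.ne', Pi.sup_apply, mul_max]
      calc max c (max (p * μ * x none) (p * μ * y none))
          = max (max p q) (max (p * (μ * x none)) (q * (ν * y none))) := by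
            rw [hc, ← mul_assoc, ← mul_assoc, hpq]
        _ = max (p * m) (q * m') := by
            rw [max_max_max_comm, hm, hm', mul_max, mul_max, mul_one, mul_one]
        _ = 1 := h1
    have hmem : (fun i => max (p / c * h i) (q / c * k i)) ∈ H := by
      refine hH _ hh _ hk _ _ ?_
      rw [max_div_div_right zero_le, ← hc, div_self hc0.ne']
    refine hH'.sup_smul_mem hx hy h1 (fun i => ?_) (hxy _ hmem (p * μ / c))
    have hcancel : ∀ a b : ℝ≥0, a / c * b * c = a * b := fun a b => by
      rw [mul_right_comm, div_mul_cancel₀ _ hc0.ne']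
    rw [hden, div_inv_eq_mul, max_mul_of_nonneg _ _ zero_le, max_mul_of_nonneg _ _ zero_le, hcancel,
      hcancel, hcancel, Pi.sup_apply, mul_max, max_max_max_comm, mul_assoc p m,
      mul_div_cancel₀ _ hm0.ne', mul_assoc q m', mul_div_cancel₀ _ hm'0.ne', mul_max, mul_max,
      ← mul_assoc, ← mul_assoc, hpq]

lemma mem_homogenization_iff {n : ℕ} {H : Set (Fin n → ℝ≥0)} (hne : H.Nonempty)
    (hc : IsClosed H) (hH : TropConvex H) (x : Fin n → ℝ≥0) :
    (fun o => o.elim 1 x) ∈ homogenization H ↔ x ∈ H := by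
  obtain ⟨h, hh⟩ := hne
  constructor
  · intro hx
    set U : Set ℝ≥0 := {u | (fun i => max (u * h i) (x i)) ∈ H} with hU
    have hUc : IsClosed U := by
      refine hc.preimage (f := fun (u : ℝ≥0) i => max (u * h i) (x i)) ?_
      fun_prop
    have hsub : Set.Ioo (0 : ℝ≥0) 1 ⊆ U := by
      rintro u ⟨hu0, hu1⟩
      have hu := hx h hh u⁻¹
      have h1 : max 1 u⁻¹ = u⁻¹ := max_eq_right ((one_le_inv₀ hu0).2 hu1.le)
      simp only [Option.elim, mul_one, h1, div_inv_eq_mul, max_mul_of_nonneg _ _ (zero_le (a := u))] at hu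
      have heq : (fun i => max (u * h i) (x i)) = fun i => max (h i * u) (u⁻¹ * x i * u) := by
        ext1 i
        rw [mul_comm u, mul_right_comm, inv_mul_cancel₀ hu0.ne', one_mul]
      rwa [← heq] at hu
    have h0 : (0 : ℝ≥0) ∈ U := by
      apply hUc.closure_subset_iff.2 hsub
      rw [closure_Ioo zero_ne_one]
      exact Set.left_mem_Icc.2 zero_le
    simpa [hU] using h0
  · intro hx h hh μ
    have h0 : max 1 μ ≠ 0 := (lt_of_lt_of_le one_pos (le_max_left _ _)).ne'
    refine hH.sup_smul_mem hh hx (α := 1 / max 1 μ) (β := μ / max 1 μ) ?_ ?_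
    · rw [max_div_div_right zero_le, div_self h0]
    · intro i
      simp only [Option.elim, mul_one]
      rw [← max_div_div_right zero_le]
      congr 1 <;> ring

lemma Finset.sup_option_eq {α : Type*} [Fintype α] [DecidableEq α] (S : Finset (Option α))
    (f : Option α → ℝ≥0) :
    S.sup f = max ((Finset.univ.filter fun a => some a ∈ S).sup fun a => f (some a))
      (if none ∈ S then f none else 0) := by
  refine le_antisymm (Finset.sup_le fun o ho => ?_)
    (max_le (Finset.sup_le fun a ha => Finset.le_sup (f := f) (Finset.mem_filter.1 ha).2) ?_)
  · cases o with
    | none => simp [ho]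
    | some a =>
      exact le_max_of_le_left (Finset.le_sup (f := fun a => f (some a)) (by simpa using ho))
  · split_ifs with h
    · exact Finset.le_sup h
    · exact zero_le

lemma max_mul_lt_max_mul {a b p q r s : ℝ≥0} (hab : max a b = 1) (hpq : p < q) (hrs : r < s) :
    max (a * p) (b * r) < max (a * q) (b * s) := by
  rcases eq_or_ne a 0 with rfl | ha
  · have hb : b = 1 := by simpa using hab
    simpa [hb] using hrs
  rcases eq_or_ne b 0 with rfl | hb
  · have ha : a = 1 := by simpa using hab
    simpa [ha] using hpq
  exact max_lt_max (mul_lt_mul_of_pos_left hpq (pos_iff_ne_zero.2 ha))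
    (mul_lt_mul_of_pos_left hrs (pos_iff_ne_zero.2 hb))

lemma max_sup_mul_combination {ι : Type*} (S : Finset ι) (c x y : ι → ℝ≥0) (d : ℝ≥0) {a b : ℝ≥0}
    (hab : max a b = 1) :
    max (S.sup fun i => c i * max (a * x i) (b * y i)) d =
      max (a * max (S.sup fun i => c i * x i) d) (b * max (S.sup fun i => c i * y i) d) := by
  have hd : d = max (a * d) (b * d) := by rw [← max_mul_of_nonneg _ _ zero_le, hab, one_mul]
  have hs : (S.sup fun i => c i * max (a * x i) (b * y i)) =
      max (a * S.sup fun i => c i * x i) (b * S.sup fun i => c i * y i) := by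
    rw [NNReal.mul_finset_sup, NNReal.mul_finset_sup, ← Finset.sup_sup]
    congr 1
    ext1 i
    simp only [Pi.sup_apply]
    rw [mul_max, mul_left_comm, mul_left_comm (c i)]
  rw [mul_max, mul_max, max_max_max_comm, ← hd, hs]

theorem stmt18 {n : ℕ} (H : Set (Fin n → ℝ≥0)) :
    (IsClosed H ∧ TropConvex H ∧ TropConvex Hᶜ) ↔
      ∃ I J L : Finset (Fin n), Disjoint I J ∧ Disjoint I L ∧ Disjoint J L ∧
        ∃ (α δ : ℝ≥0) (β γ : Fin n → ℝ≥0),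
          (∀ i ∈ I, 0 < β i) ∧ (∀ j ∈ J, 0 < γ j) ∧
          H = {x | max (J.sup fun j => γ j * x j) α ≤ max (I.sup fun i => β i * x i) δ ∧
                ∀ j ∈ L, x j = 0} := by
  constructor
  · rintro ⟨hc, hH, hH'⟩
    rcases H.eq_empty_or_nonempty with rfl | hne
    · exact ⟨∅, ∅, ∅, by simp, by simp, by simp, 1, 0, 0, 0, by simp, by simp, by simp⟩
    obtain ⟨I, J, L, hIJ, hIL, hJL, β, γ, hβ, hγ, hmem⟩ :=
      (isConicHemispace_homogenization hH hH').exists_halfspace (isClosed_homogenization hc)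
    have hnL : none ∉ L := by
      intro hL
      obtain ⟨x, hx⟩ := hne
      have := ((hmem _).1 ((mem_homogenization_iff ⟨x, hx⟩ hc hH x).2 hx)).2 none hL
      simp at this
    have hdisj : ∀ S T : Finset (Option (Fin n)), Disjoint S T →
        Disjoint (Finset.univ.filter fun a => some a ∈ S)
          (Finset.univ.filter fun a => some a ∈ T) := by
      intro S T hST
      rw [Finset.disjoint_left] at hST ⊢
      intro a ha hb
      exact hST (Finset.mem_filter.1 ha).2 (Finset.mem_filter.1 hb).2
    refine ⟨Finset.univ.filter fun a => some a ∈ I, Finset.univ.filter fun a => some a ∈ J,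
      Finset.univ.filter fun a => some a ∈ L, hdisj _ _ hIJ, hdisj _ _ hIL, hdisj _ _ hJL,
      if none ∈ J then γ none else 0, if none ∈ I then β none else 0,
      fun i => β (some i), fun j => γ (some j), fun i hi => hβ _ (by simpa using hi),
      fun j hj => hγ _ (by simpa using hj), ?_⟩
    ext x
    rw [← mem_homogenization_iff hne hc hH x, hmem, Finset.sup_option_eq, Finset.sup_option_eq]
    simp only [Option.elim, mul_one, Set.mem_ofPred_eq, Finset.mem_filter, Finset.mem_univ,
      true_and]
    refine and_congr Iff.rfl ⟨fun h j hj => h _ hj, fun h o ho => ?_⟩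
    cases o with
    | none => exact absurd ho hnL
    | some j => exact h j ho
  · rintro ⟨I, J, L, -, -, -, α, δ, β, γ, -, -, rfl⟩
    refine ⟨?_, ?_, ?_⟩
    · have hcont : ∀ (S : Finset (Fin n)) (c : Fin n → ℝ≥0) (d : ℝ≥0),
          Continuous fun x : Fin n → ℝ≥0 => max (S.sup fun i => c i * x i) d := by
        intro S c d
        refine Continuous.max (Continuous.finset_sup_apply fun i _ => ?_) continuous_const
        fun_prop
      refine (isClosed_le (hcont J γ α) (hcont I β δ)).inter ?_
      change IsClosed {x : Fin n → ℝ≥0 | ∀ j ∈ L, x j = 0}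
      simp only [Set.ofPred_forall]
      exact isClosed_iInter fun j => isClosed_iInter fun _ =>
        isClosed_eq (continuous_apply j) continuous_const
    · rintro x ⟨hx, hxL⟩ y ⟨hy, hyL⟩ a b hab
      refine ⟨?_, fun j hj => by simp [hxL j hj, hyL j hj]⟩
      rw [max_sup_mul_combination _ _ _ _ _ hab, max_sup_mul_combination _ _ _ _ _ hab]
      gcongr
    · rintro x hx y hy a b hab ⟨hz, hzL⟩
      rcases eq_or_ne a 0 with rfl | ha
      · have hb : b = 1 := by simpa using hab
        subst hb
        exact hy (by simpa using And.intro hz hzL)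
      rcases eq_or_ne b 0 with rfl | hb
      · have ha : a = 1 := by simpa using hab
        subst ha
        exact hx (by simpa using And.intro hz hzL)
      have hL : ∀ j ∈ L, x j = 0 ∧ y j = 0 := by
        intro j hj
        have h1 : max (a * x j) (b * y j) = 0 := hzL j hj
        have h2 : a * x j = 0 := le_antisymm (h1 ▸ le_max_left _ _) zero_le
        have h3 : b * y j = 0 := le_antisymm (h1 ▸ le_max_right _ _) zero_le
        exact ⟨(mul_eq_zero.1 h2).resolve_left ha, (mul_eq_zero.1 h3).resolve_left hb⟩
      have hx' := lt_of_not_ge fun h => hx ⟨h, fun j hj => (hL j hj).1⟩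
      have hy' := lt_of_not_ge fun h => hy ⟨h, fun j hj => (hL j hj).2⟩
      rw [max_sup_mul_combination _ _ _ _ _ hab, max_sup_mul_combination _ _ _ _ _ hab] at hz
      exact absurd hz (not_le.2 (max_mul_lt_max_mul hab hx' hy'))
end
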